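/- Let G be a graph with α(G) ≥ 3 that is not a join of two proper subgraphs. Then G is a locally triangle-free graph in W₂ if and only if G is a triangle-free graph in W₂, or G is isomorphic to one of the four exceptional graphs Q₉, Q₁₂, P₁₀, P₁₂. -/

import Mathlib

open Set

variable {V : Type*}

/-- `S` is an independent set of `G` contained in the vertex subset `W`
(i.e. an independent set of the induced subgraph `G[W]`). -/
def IsIndepOn (G : SimpleGraph V) (W S : Set V) : Prop :=
  S ⊆ W ∧ ∀ ⦃x⦄, x ∈ S → ∀ ⦃y⦄, y ∈ S → ¬ G.Adj x y

/-- `S` is a maximal independent set of the induced subgraph `G[W]`. -/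
def MaxIndepOn (G : SimpleGraph V) (W : Set V) (S : Finset V) : Prop :=
  IsIndepOn G W ↑S ∧ ∀ v ∈ W, v ∉ S → ¬ IsIndepOn G W (insert v ↑S)

/-- The independence number of the induced subgraph `G[W]`. -/
noncomputable def indepNumOn (G : SimpleGraph V) (W : Set V) : ℕ :=
  sSup {n | ∃ S : Finset V, IsIndepOn G W ↑S ∧ S.card = n}

/-- The induced subgraph `G[W]` is well-covered: every maximal independent set
has cardinality equal to the independence number. -/
def WellCoveredOn (G : SimpleGraph V) (W : Set V) : Prop :=
  ∀ S : Finset V, MaxIndepOn G W S → S.card = indepNumOn G W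

/-- The independence number `α(G)`. -/
noncomputable def indepNum (G : SimpleGraph V) : ℕ := indepNumOn G Set.univ

/-- `G` is well-covered. -/
def WellCovered (G : SimpleGraph V) : Prop := WellCoveredOn G Set.univ

/-- The induced subgraph `G[W]` has no isolated vertices. -/
def NoIsolatedOn (G : SimpleGraph V) (W : Set V) : Prop :=
  ∀ v ∈ W, ∃ u ∈ W, G.Adj v u

/-- The induced subgraph `G[W]` is in the class `W₂`: it has no isolated
vertices, is well-covered, and removing any vertex leaves a well-covered graph
with the same independence number. -/
def W2On (G : SimpleGraph V) (W : Set V) : Prop :=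
  NoIsolatedOn G W ∧ WellCoveredOn G W ∧
    ∀ v ∈ W, WellCoveredOn G (W \ {v}) ∧ indepNumOn G (W \ {v}) = indepNumOn G W

/-- `G` is in the class `W₂`. -/
def W2 (G : SimpleGraph V) : Prop := W2On G Set.univ

/-- The closed neighborhood `N_G[S]` of a set of vertices `S`. -/
def nbhd (G : SimpleGraph V) (S : Set V) : Set V :=
  {v | v ∈ S ∨ ∃ u ∈ S, G.Adj u v}

/-- The vertex set of `G_S = G \ N_G[S]`. -/
def GDel (G : SimpleGraph V) (S : Set V) : Set V := Set.univ \ nbhd G S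

/-- The induced subgraph `G[W]` is triangle-free. -/
def TriangleFreeOn (G : SimpleGraph V) (W : Set V) : Prop :=
  ∀ x ∈ W, ∀ y ∈ W, ∀ z ∈ W, ¬ (G.Adj x y ∧ G.Adj y z ∧ G.Adj x z)

/-- `G` is locally triangle-free: `G_v` is triangle-free for every vertex `v`. -/
def LocallyTriangleFree (G : SimpleGraph V) : Prop :=
  ∀ v : V, TriangleFreeOn G (GDel G {v})

/-- `G` is a join of two proper (nonempty, disjoint) subgraphs. -/
def IsJoin (G : SimpleGraph V) : Prop :=
  ∃ V₁ V₂ : Set V, V₁.Nonempty ∧ V₂.Nonempty ∧ Disjoint V₁ V₂ ∧ V₁ ∪ V₂ = Set.univ ∧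
    ∀ x ∈ V₁, ∀ y ∈ V₂, G.Adj x y

/-- The edge list of the graph `Q₉`: vertices `a,b,c = 0,1,2`,
`a₁,a₂ = 3,4`, `b₁,b₂ = 5,6`, `c₁,c₂ = 7,8`. -/
def edgesQ9 : List (Fin 9 × Fin 9) :=
  [(0,1),(0,2),(1,2),(0,3),(0,4),(1,5),(1,6),(2,7),(2,8),
   (3,7),(7,5),(5,4),(4,8),(8,6),(6,3)]

/-- The exceptional graph `Q₉`. -/
def Q9 : SimpleGraph (Fin 9) := SimpleGraph.fromRel (fun u v => (u, v) ∈ edgesQ9)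

/-- The edge list of the graph `Q₁₂`: vertices `a,b,c = 0,1,2`,
`a₁,a₂,a₃ = 3,4,5`, `b₁,b₂,b₃ = 6,7,8`, `c₁,c₂,c₃ = 9,10,11`. -/
def edgesQ12 : List (Fin 12 × Fin 12) :=
  [(0,1),(0,2),(1,2),(0,3),(0,4),(0,5),(1,6),(1,7),(1,8),(2,9),(2,10),(2,11),
   (3,9),(4,10),(5,11),(6,9),(7,10),(8,11),(5,6),(4,8),(3,7)]

/-- The exceptional graph `Q₁₂`. -/
def Q12 : SimpleGraph (Fin 12) := SimpleGraph.fromRel (fun u v => (u, v) ∈ edgesQ12)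

/-- The edge list of the graph `P₁₀`: vertices `a,b,c = 0,1,2`, `x,y = 3,4`,
`a₁ = 5`, `b₁,b₂ = 6,7`, `c₁,c₂ = 8,9`. -/
def edgesP10 : List (Fin 10 × Fin 10) :=
  [(0,1),(0,2),(0,5),(0,3),(0,4),(1,2),(1,6),(1,7),(2,8),(2,9),
   (3,4),(3,7),(3,8),(4,6),(4,9),(5,6),(5,7),(5,8),(5,9),(6,8),(7,9)]

/-- The exceptional graph `P₁₀`. -/
def P10 : SimpleGraph (Fin 10) := SimpleGraph.fromRel (fun u v => (u, v) ∈ edgesP10)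

/-- The edge list of the graph `P₁₂`: vertices `a,b,c,d = 0,1,2,3`,
`x,y,z,t = 4,5,6,7`, `a₁ = 8`, `b₁ = 9`, `c₁,c₂ = 10,11`. -/
def edgesP12 : List (Fin 12 × Fin 12) :=
  [(0,1),(0,8),(0,2),(0,3),(0,4),(0,5),(1,9),(1,2),(1,3),(1,7),(1,6),
   (2,4),(2,6),(2,10),(2,11),(3,5),(3,7),(3,10),(3,11),(8,9),
   (8,6),(8,7),(8,10),(8,11),(9,4),(9,5),(9,10),(9,11),
   (4,5),(4,7),(4,10),(5,6),(5,11),(6,7),(6,10),(7,11)]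

/-- The exceptional graph `P₁₂`. -/
def P12 : SimpleGraph (Fin 12) := SimpleGraph.fromRel (fun u v => (u, v) ∈ edgesP12)

/-- Distinct non-adjacent vertices, i.e. adjacent vertices of the complement. -/
def Far (G : SimpleGraph V) (x y : V) : Prop := x ≠ y ∧ ¬ G.Adj x y

/-- `S` is an independent set of `G`. -/
def Indep (G : SimpleGraph V) (S : Finset V) : Prop := ∀ x ∈ S, ∀ y ∈ S, ¬ G.Adj x y

/-- `v` is a vertex of `G \ N[S]`. -/
def Link (G : SimpleGraph V) (S : Finset V) (v : V) : Prop := ∀ s ∈ S, Far G s v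

theorem Far.symm {G : SimpleGraph V} {x y : V} (h : Far G x y) : Far G y x :=
  ⟨h.1.symm, fun h' => h.2 h'.symm⟩

theorem far_comm {G : SimpleGraph V} {x y : V} : Far G x y ↔ Far G y x :=
  ⟨Far.symm, Far.symm⟩

theorem Link.notMem {G : SimpleGraph V} {S : Finset V} {v : V} (h : Link G S v) : v ∉ S :=
  fun hv => (h v hv).1 rfl

theorem Indep.insert [DecidableEq V] {G : SimpleGraph V} {S : Finset V} {v : V}
    (hS : Indep G S) (h : Link G S v) : Indep G (insert v S) := by
  intro x hx y hy hxy
  rw [Finset.mem_insert] at hx hy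
  rcases hx with rfl | hx <;> rcases hy with rfl | hy
  · exact G.irrefl hxy
  · exact (h y hy).2 hxy.symm
  · exact (h x hx).2 hxy
  · exact hS x hx y hy hxy

theorem Indep.mono {G : SimpleGraph V} {S T : Finset V} (hT : Indep G T) (h : S ⊆ T) :
    Indep G S := fun x hx y hy => hT x (h hx) y (h hy)

theorem link_insert [DecidableEq V] {G : SimpleGraph V} {S : Finset V} {u v : V} :
    Link G (insert u S) v ↔ Far G u v ∧ Link G S v := by
  simp [Link]

section Finite

variable [Fintype V]

theorem card_le_indepNumOn {G : SimpleGraph V} {W : Set V} {S : Finset V}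
    (hS : IsIndepOn G W ↑S) : S.card ≤ indepNumOn G W := by
  refine le_csSup ⟨Fintype.card V, ?_⟩ ⟨S, hS, rfl⟩
  rintro n ⟨T, -, rfl⟩
  exact T.card_le_univ

theorem exists_card_eq_indepNumOn (G : SimpleGraph V) (W : Set V) :
    ∃ S : Finset V, IsIndepOn G W ↑S ∧ S.card = indepNumOn G W := by
  refine Nat.sSup_mem (s := {n | ∃ S : Finset V, IsIndepOn G W ↑S ∧ S.card = n})
    ⟨0, ∅, by simp [IsIndepOn], rfl⟩ ⟨Fintype.card V, ?_⟩
  rintro n ⟨T, -, rfl⟩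
  exact T.card_le_univ

theorem exists_maxIndepOn_superset {G : SimpleGraph V} {W : Set V} {S : Finset V}
    (hS : IsIndepOn G W ↑S) : ∃ T : Finset V, S ⊆ T ∧ MaxIndepOn G W T := by
  classical
  obtain ⟨T, hST, hT⟩ := (Set.toFinite {T : Finset V | IsIndepOn G W ↑T}).exists_le_maximal hS
  refine ⟨T, hST, hT.prop, fun v _ hvT hv => hvT ?_⟩
  have := hT.le_of_ge (y := insert v T) (by simpa using hv) (Finset.subset_insert v T)
  exact this (Finset.mem_insert_self v T)

/-- Well-covered graphs all of whose graphs `G \ N[S]` have no isolated vertices, in terms of the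
independent sets. -/
structure IsW2 (G : SimpleGraph V) (n : ℕ) : Prop where
  card_le : ∀ S, Indep G S → S.card ≤ n
  exists_link : ∀ S, Indep G S → S.card < n → ∃ v, Link G S v
  exists_adj : ∀ S v, Indep G S → Link G S v → ∃ w, Link G S w ∧ G.Adj v w

theorem W2.isW2 {G : SimpleGraph V} (h : W2 G) : IsW2 G (indepNum G) := by
  classical
  obtain ⟨-, hwc, hdel⟩ := h
  refine ⟨fun S hS => card_le_indepNumOn ⟨subset_univ _, hS⟩, fun S hS hcard => ?_,
    fun S v hS hv => ?_⟩
  · by_contra! hno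
    refine hcard.ne (hwc S ⟨⟨subset_univ _, hS⟩, fun v _ hvS hv => hno v fun s hs => ⟨?_, ?_⟩⟩)
    · rintro rfl
      exact hvS hs
    · exact hv.2 (mem_insert_of_mem _ hs) (mem_insert _ _)
  · by_contra! hno
    obtain ⟨T, hST, hT⟩ := exists_maxIndepOn_superset (G := G) (W := Set.univ \ {v}) (S := S)
      ⟨fun x hx => ⟨mem_univ _, fun hxv => hv.notMem (hxv ▸ hx)⟩, hS⟩
    have hcard : T.card = indepNum G := ((hdel v (mem_univ v)).1 T hT).trans
      (hdel v (mem_univ v)).2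
    have hvT : v ∉ T := fun hvT => (hT.1.1 hvT).2 rfl
    have hlink : Link G T v := fun t ht => by
      refine ⟨fun h => hvT (h ▸ ht), fun hadj => ?_⟩
      by_cases htS : t ∈ S
      · exact (hv t htS).2 hadj
      · refine hno t (fun s hs => ⟨fun h => htS (h ▸ hs), ?_⟩) hadj.symm
        exact hT.1.2 (hST hs) ht
    have := card_le_indepNumOn (G := G) (W := Set.univ) (S := insert v T)
      ⟨subset_univ _, Indep.insert hT.1.2 hlink⟩
    rw [Finset.card_insert_of_notMem hvT, hcard] at this
    exact absurd this (by simp [indepNum])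

theorem IsW2.indepNumOn_eq {G : SimpleGraph V} {n : ℕ} (h : IsW2 G n) {W : Set V}
    (hW : ∀ S, Indep G S → ↑S ⊆ W → S.card < n → ∃ w ∈ W, Link G S w) :
    WellCoveredOn G W ∧ indepNumOn G W = n := by
  classical
  have hmax : ∀ S : Finset V, MaxIndepOn G W S → S.card = n := fun S hS => by
    refine (h.card_le S hS.1.2).antisymm (not_lt.1 fun hlt => ?_)
    obtain ⟨w, hwW, hw⟩ := hW S hS.1.2 hS.1.1 hlt
    refine hS.2 w hwW hw.notMem ⟨insert_subset hwW hS.1.1, ?_⟩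
    have := hS.1.2
    simpa [Indep] using Indep.insert (G := G) (S := S) this hw
  obtain ⟨T, -, hT⟩ := exists_maxIndepOn_superset (G := G) (W := W) (S := ∅)
    (by simp [IsIndepOn])
  have hnum : indepNumOn G W = n := by
    refine le_antisymm ?_ ((hmax T hT) ▸ card_le_indepNumOn hT.1)
    obtain ⟨S, hS, hcard⟩ := exists_card_eq_indepNumOn G W
    exact hcard ▸ h.card_le S hS.2
  exact ⟨fun S hS => (hmax S hS).trans hnum.symm, hnum⟩

theorem IsW2.w2 {G : SimpleGraph V} {n : ℕ} (h : IsW2 G n) : W2 G := by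
  classical
  have huniv := h.indepNumOn_eq (W := Set.univ) fun S hS _ hlt =>
    (h.exists_link S hS hlt).imp fun w hw => ⟨mem_univ w, hw⟩
  refine ⟨fun v _ => ?_, huniv.1, fun v _ => ?_⟩
  · obtain ⟨w, -, hw⟩ := h.exists_adj ∅ v (by simp [Indep]) (by simp [Link])
    exact ⟨w, mem_univ w, hw⟩
  · have := h.indepNumOn_eq (W := Set.univ \ {v}) fun S hS hSv hlt => by
      obtain ⟨w, hw⟩ := h.exists_link S hS hlt
      by_cases hwv : w = v
      · obtain ⟨u, hu, hadj⟩ := h.exists_adj S w hS hw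
        exact ⟨u, ⟨mem_univ u, fun huv => hadj.ne (hwv.trans huv.symm)⟩, hu⟩
      · exact ⟨w, ⟨mem_univ w, hwv⟩, hw⟩
    exact ⟨this.1, this.2.trans huniv.2.symm⟩

end Finite

/-- Locally triangle-free graphs in `W₂` with independence number `n`. -/
structure IsLTFW2 (G : SimpleGraph V) (n : ℕ) : Prop extends IsW2 G n where
  not_triangle : ∀ v x y z, Far G v x → Far G v y → Far G v z →
    G.Adj x y → G.Adj y z → G.Adj x z → False

theorem not_triangle_of_locallyTriangleFree {G : SimpleGraph V} (h : LocallyTriangleFree G)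
    (v x y z : V) (hx : Far G v x) (hy : Far G v y) (hz : Far G v z)
    (hxy : G.Adj x y) (hyz : G.Adj y z) (hxz : G.Adj x z) : False := by
  have key : ∀ u, Far G v u → u ∈ GDel G {v} := fun u hu => by
    refine ⟨mem_univ u, ?_⟩
    rintro (h | ⟨w, rfl, h⟩)
    · exact hu.1 h.symm
    · exact hu.2 h
  exact h v x (key x hx) y (key y hy) z (key z hz) ⟨hxy, hyz, hxz⟩

theorem eq_univ_of_not_isJoin {G : SimpleGraph V} (hjoin : ¬ IsJoin G) {U : Set V} {u : V}
    (hu : u ∈ U) (hU : ∀ x ∈ U, ∀ y, Far G x y → y ∈ U) : U = Set.univ := by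
  by_contra hne
  refine hjoin ⟨U, Uᶜ, ⟨u, hu⟩, nonempty_compl.2 hne, disjoint_compl_right, union_compl_self U,
    fun x hx y hy => ?_⟩
  by_contra hxy
  exact hy (hU x hx y ⟨fun h => hy (h ▸ hx), hxy⟩)

namespace IsLTFW2

variable {G : SimpleGraph V} {n : ℕ}

theorem exists_link_far (h : IsLTFW2 G n) {T : Finset V} {c i s : V} (hT : Indep G T)
    (hcard : T.card < n) (hi : i ∈ T) (hic : Far G i c) (hs : s ∈ T) (hsc : ¬ Far G s c) :
    ∃ v, Link G T v ∧ Far G v c := by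
  by_contra! hno
  have hadj : ∀ v, Link G T v → G.Adj c v := fun v hv => by
    by_contra hcv
    refine hno v hv ⟨?_, fun h' => hcv h'.symm⟩
    rintro rfl
    exact hsc (hv s hs)
  obtain ⟨v, hv⟩ := h.exists_link T hT hcard
  obtain ⟨w, hw, hvw⟩ := h.exists_adj T v hT hv
  exact h.not_triangle i c v w hic (hv i hi) (hw i hi) (hadj v hv) hvw (hadj w hw)

theorem adj_of_link [DecidableEq V] (h : IsLTFW2 G n) {T : Finset V} {u v : V} (hT : Indep G T)
    (hcard : n ≤ T.card + 1) (hu : Link G T u) (hv : Link G T v) (huv : u ≠ v) : G.Adj u v := by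
  by_contra hadj
  have hl : Link G (insert u T) v := link_insert.2 ⟨⟨huv, hadj⟩, hv⟩
  have := h.card_le _ ((hT.insert hu).insert hl)
  rw [Finset.card_insert_of_notMem hl.notMem, Finset.card_insert_of_notMem hu.notMem] at this
  omega

theorem eq_or_eq_of_link [DecidableEq V] (h : IsLTFW2 G n) {T : Finset V} {s u v w : V}
    (hT : Indep G T) (hs : s ∈ T) (hcard : n ≤ T.card + 1) (hu : Link G T u) (hv : Link G T v)
    (hw : Link G T w) (huv : u ≠ v) : w = u ∨ w = v := by
  by_contra! hne
  exact h.not_triangle s u v w (hu s hs) (hv s hs) (hw s hs) (h.adj_of_link hT hcard hu hv huv)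
    (h.adj_of_link hT hcard hv hw hne.2.symm) (h.adj_of_link hT hcard hu hw hne.1.symm)

theorem not_link (h : IsLTFW2 G n) {T : Finset V} (hT : Indep G T)
    (hcard : n ≤ T.card) (u : V) : ¬ Link G T u := by
  classical
  intro hu
  have := h.card_le _ (hT.insert hu)
  rw [Finset.card_insert_of_notMem hu.notMem] at this
  omega

/-- Starting from an independent set, one may add vertices of `{v | Far G v c}` until
the independence number is reached. -/
theorem exists_superset_far [DecidableEq V] (h : IsLTFW2 G n) {T : Finset V} {c i s : V}
    (hT : Indep G T) (hi : i ∈ T) (hic : Far G i c) (hs : s ∈ T) (hsc : ¬ Far G s c) :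
    ∃ S, Indep G (T ∪ S) ∧ Disjoint T S ∧ (T ∪ S).card = n ∧ ∀ v ∈ S, Far G v c := by
  induction hk : n - T.card generalizing T with
  | zero =>
    have := h.card_le T hT
    exact ⟨∅, by simpa using hT, by simp, by simp; omega, by simp⟩
  | succ k ih =>
    obtain ⟨v, hv, hvc⟩ := h.exists_link_far hT (by omega) hi hic hs hsc
    obtain ⟨S, hS, hdisj, hcard, hfar⟩ := ih (hT.insert hv) (Finset.mem_insert_of_mem hi)
      (Finset.mem_insert_of_mem hs) (by rw [Finset.card_insert_of_notMem hv.notMem]; omega)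
    refine ⟨insert v S, ?_, ?_, ?_, ?_⟩
    · rwa [Finset.union_insert, ← Finset.insert_union]
    · rw [Finset.disjoint_insert_right]
      exact ⟨hv.notMem, hdisj.mono_left (Finset.subset_insert v T)⟩
    · rwa [Finset.union_insert, ← Finset.insert_union]
    · simpa [hvc] using hfar

/-- If `c` is adjacent or equal to some element of `T` and not to another, then the vertices of
`G \ N[T]` not adjacent to `c`, when they form an independent set,
number as many as the independence number allows. -/
theorem card_eq_of_indep [DecidableEq V] (h : IsLTFW2 G n) {T S : Finset V} {c s i : V}
    (hTS : Indep G (T ∪ S)) (hs : s ∈ T) (hsc : ¬ Far G s c) (hi : i ∈ T ∪ S) (hic : Far G i c)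
    (hS : ∀ v, Link G T v → Far G v c → v ∈ S) : (T ∪ S).card = n := by
  refine (h.card_le _ hTS).antisymm (not_lt.1 fun hlt => ?_)
  obtain ⟨v, hv, hvc⟩ := h.exists_link_far hTS hlt hi hic (Finset.mem_union_left S hs) hsc
  exact hv.notMem (Finset.mem_union_right T
    (hS v (fun t ht => hv t (Finset.mem_union_left S ht)) hvc))

end IsLTFW2

namespace IsLTFW2

variable {G : SimpleGraph V} {n : ℕ}

/-- The configuration excluded by `IsLTFW2.not_separated`: within `G \ N[Q]`, the vertices
`w` not adjacent to `c`, `y` not adjacent to `a`, and `d` adjacent or equal to both. -/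
structure Separated (G : SimpleGraph V) (Q : Finset V) (a b c w y d : V) : Prop where
  indep : Indep G Q
  mem : b ∈ Q
  adj_left : G.Adj b a
  adj_right : G.Adj b c
  not_far : ∀ v, Link G Q v → Far G v a → ¬ Far G v c
  link_w : Link G Q w
  far_w : Far G w c
  link_y : Link G Q y
  far_y : Far G y a
  link_d : Link G Q d
  not_far_left : ¬ Far G d a
  not_far_right : ¬ Far G d c

theorem Separated.symm {Q : Finset V} {a b c w y d : V} (h : Separated G Q a b c w y d) :
    Separated G Q c b a y w d where
  indep := h.indep
  mem := h.mem
  adj_left := h.adj_right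
  adj_right := h.adj_left
  not_far v hv hc ha := h.not_far v hv ha hc
  link_w := h.link_y
  far_w := h.far_y
  link_y := h.link_w
  far_y := h.far_w
  link_d := h.link_d
  not_far_left := h.not_far_right
  not_far_right := h.not_far_left

variable [DecidableEq V]

theorem not_separated_of_card_eq (h : IsLTFW2 G n) {Q : Finset V} {a b c w y d : V}
    (hs : Separated G Q a b c w y d) (hcard : Q.card + 3 = n) (hwd : Far G w d)
    (hwy : Far G w y) : False := by
  have hba : ¬ Far G b a := fun h' => h'.2 hs.adj_left
  have hbc : ¬ Far G b c := fun h' => h'.2 hs.adj_right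
  have hR : Indep G (insert w Q) := hs.indep.insert hs.link_w
  have hRc : (insert w Q).card = Q.card + 1 := Finset.card_insert_of_notMem hs.link_w.notMem
  have hb : b ∈ insert w Q := Finset.mem_insert_of_mem hs.mem
  have hwR : w ∈ insert w Q := Finset.mem_insert_self _ _
  have hyR : Link G (insert w Q) y := link_insert.2 ⟨hwy, hs.link_y⟩
  have hdR : Link G (insert w Q) d := link_insert.2 ⟨hwd, hs.link_d⟩
  -- every vertex of `G \ N[Q ∪ w]` has a non-neighbour not adjacent to `c`
  have hA : ∀ v, Link G (insert w Q) v → ∃ x, Link G (insert w Q) x ∧ Far G v x ∧ Far G x c := by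
    intro v hv
    obtain ⟨x, hx, hxc⟩ := h.exists_link_far (hR.insert hv)
      (by rw [Finset.card_insert_of_notMem hv.notMem]; omega)
      (Finset.mem_insert_of_mem hwR) hs.far_w (Finset.mem_insert_of_mem hb) hbc
    rw [link_insert] at hx
    exact ⟨x, hx.2, hx.1, hxc⟩
  have hC : ∀ v, Link G (insert w Q) v → Far G v a →
      ∃ x, Link G (insert w Q) x ∧ Far G v x ∧ Far G x a := by
    intro v hv hva
    obtain ⟨x, hx, hxc⟩ := h.exists_link_far (hR.insert hv)
      (by rw [Finset.card_insert_of_notMem hv.notMem]; omega)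
      (Finset.mem_insert_self v _) hva (Finset.mem_insert_of_mem hb) hba
    rw [link_insert] at hx
    exact ⟨x, hx.2, hx.1, hxc⟩
  have htwo : ∀ v x z t, Link G (insert w Q) v → Link G (insert w Q) x → Link G (insert w Q) z →
      Link G (insert w Q) t → Far G v x → Far G v z → Far G v t → x ≠ z → t = x ∨ t = z := by
    intro v x z t hv hx hz ht h1 h2 h3 hxz
    exact h.eq_or_eq_of_link (T := insert v (insert w Q)) (hR.insert hv)
      (Finset.mem_insert_self v _) (by rw [Finset.card_insert_of_notMem hv.notMem]; omega)
      (link_insert.2 ⟨h1, hx⟩) (link_insert.2 ⟨h2, hz⟩) (link_insert.2 ⟨h3, ht⟩) hxz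
  have hadj : ∀ v x z, Link G (insert w Q) v → Link G (insert w Q) x → Link G (insert w Q) z →
      Far G v x → Far G v z → x ≠ z → G.Adj x z := by
    intro v x z hv hx hz h1 h2 hxz
    exact h.adj_of_link (T := insert v (insert w Q)) (hR.insert hv)
      (by rw [Finset.card_insert_of_notMem hv.notMem]; omega)
      (link_insert.2 ⟨h1, hx⟩) (link_insert.2 ⟨h2, hz⟩) hxz
  have htri : ∀ x z t, Link G (insert w Q) x → Link G (insert w Q) z → Link G (insert w Q) t →
      G.Adj x z → G.Adj z t → G.Adj x t → False := fun x z t hx hz ht =>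
    h.not_triangle w x z t (hx w hwR) (hz w hwR) (ht w hwR)
  have hnf : ∀ v, Link G (insert w Q) v → Far G v a → ¬ Far G v c := fun v hv =>
    hs.not_far v (link_insert.1 hv).2
  obtain ⟨x₂, hx₂, hyx₂, hx₂c⟩ := hA y hyR
  obtain ⟨y', hy', hyy', hy'a⟩ := hC y hyR hs.far_y
  obtain ⟨x₃, hx₃, hyx₃, hx₃c⟩ := hA y' hy'
  have h1 := hs.far_y
  have h2 := hs.not_far_left
  have h3 := hs.not_far_right
  obtain ⟨x₄, hx₄, hxx₄, hx₄c⟩ := hA x₂ hx₂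
  have k1 := hnf x₂ hx₂
  have k2 := hnf x₃ hx₃
  have k3 := hnf x₄ hx₄
  have n1 : x₂ ≠ y' := by rintro rfl; exact k1 hy'a hx₂c
  have n2 : x₃ ≠ y := by rintro rfl; exact k2 h1 hx₃c
  have n3 : x₂ ≠ d := by rintro rfl; exact h3 hx₂c
  have n4 : x₃ ≠ d := by rintro rfl; exact h3 hx₃c
  have n5 : y ≠ d := by rintro rfl; exact h2 h1
  have n6 : y' ≠ d := by rintro rfl; exact h2 hy'a
  have a1 : G.Adj x₂ y' := hadj y x₂ y' hyR hx₂ hy' hyx₂ hyy' n1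
  have a2 : G.Adj x₃ y := hadj y' x₃ y hy' hx₃ hyR hyx₃ hyy'.symm n2
  have a3 : G.Adj y d := by
    by_contra hn
    rcases htwo y x₂ y' d hyR hx₂ hy' hdR hyx₂ hyy' ⟨n5, hn⟩ n1 with rfl | rfl
    exacts [n3 rfl, n6 rfl]
  have a4 : G.Adj y' d := by
    by_contra hn
    rcases htwo y' x₃ y d hy' hx₃ hyR hdR hyx₃ hyy'.symm ⟨n6, hn⟩ n2 with rfl | rfl
    exacts [n4 rfl, n5 rfl]
  have f1 : Far G d x₃ := ⟨n4.symm, fun hn => htri x₃ y d hx₃ hyR hdR a2 a3 hn.symm⟩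
  have f2 : Far G d x₂ := ⟨n3.symm, fun hn => htri x₂ y' d hx₂ hy' hdR a1 a4 hn.symm⟩
  rcases htwo x₂ y d x₄ hx₂ hyR hdR hx₄ hyx₂.symm f2.symm hxx₄ n5 with rfl | rfl
  exacts [k3 h1 hx₄c, h3 hx₄c]

theorem not_separated (h : IsLTFW2 G n) {Q : Finset V} {a b c w y d : V}
    (hs : Separated G Q a b c w y d) (hcard : Q.card + 3 ≤ n) : False := by
  induction hk : n - Q.card generalizing Q a c w y d with
  | zero => omega
  | succ k ih =>
  have key : ∀ {a c w y d}, Separated G Q a b c w y d → Far G w d → ¬ Far G w y := by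
    intro a c w y d hs hwd hwy
    rcases hcard.eq_or_lt with heq | hlt
    · exact h.not_separated_of_card_eq hs heq hwd hwy
    · have hbc : ¬ Far G b c := fun h' => h'.2 hs.adj_right
      have hR : Indep G (insert w Q) := hs.indep.insert hs.link_w
      have hRc : (insert w Q).card = Q.card + 1 :=
        Finset.card_insert_of_notMem hs.link_w.notMem
      obtain ⟨x, hx, hxc⟩ := h.exists_link_far hR (by omega) (Finset.mem_insert_self w Q) hs.far_w
        (Finset.mem_insert_of_mem hs.mem) hbc
      exact ih (Q := insert w Q) (a := a) (c := c) (w := x) (y := y) (d := d)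
        { indep := hR
          mem := Finset.mem_insert_of_mem hs.mem
          adj_left := hs.adj_left
          adj_right := hs.adj_right
          not_far := fun v hv => hs.not_far v (link_insert.1 hv).2
          link_w := hx
          far_w := hxc
          link_y := link_insert.2 ⟨hwy, hs.link_y⟩
          far_y := hs.far_y
          link_d := link_insert.2 ⟨hwd, hs.link_d⟩
          not_far_left := hs.not_far_left
          not_far_right := hs.not_far_right } (by omega) (by omega)
  -- a vertex adjacent to all of `{v | Far G v a}` prevents any vertex from missing it
  have full : ∀ {a c w y d}, Separated G Q a b c w y d → ∀ u x, Link G Q u → Link G Q x →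
      (∀ v, Link G Q v → Far G v a → G.Adj u v) →
      ¬ ∀ v, Link G Q v → Far G v a → Far G x v := by
    intro a c w y d hs u x hu hx hadj hfar
    have hba : ¬ Far G b a := fun h' => h'.2 hs.adj_left
    obtain ⟨S, hS, hdisj, hScard, hSa⟩ := h.exists_superset_far (c := a)
      (hs.indep.insert hs.link_y) (Finset.mem_insert_self y Q) hs.far_y
      (Finset.mem_insert_of_mem hs.mem) hba
    refine h.not_link hS hScard.ge x fun t ht => ?_
    rw [Finset.mem_union, Finset.mem_insert] at ht
    rcases ht with (rfl | ht) | ht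
    · exact (hfar t hs.link_y hs.far_y).symm
    · exact hx t ht
    · refine (hfar t (fun q hq => ?_) (hSa t ht)).symm
      refine ⟨fun heq => ?_, hS q (by simp [hq]) t (by simp [ht])⟩
      exact Finset.disjoint_left.1 hdisj (by simp [hq]) (heq ▸ ht)
  have main : ∀ {a c w y d}, Separated G Q a b c w y d → ¬ Far G w d := by
    intro a c w y d hs hwd
    have hbc : ¬ Far G b c := fun h' => h'.2 hs.adj_right
    have hne : ∀ x v, Link G Q x → Link G Q v → Far G x c → Far G v a → x ≠ v := by
      rintro x _ hx hv hxc hva rfl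
      exact hs.not_far x hx hva hxc
    have hadj : ∀ x, Link G Q x → Far G x c → Far G x d →
        ∀ v, Link G Q v → Far G v a → G.Adj x v := by
      intro x hx hxc hxd v hv hva
      by_contra hn
      refine key (a := a) (c := c) (w := x) (y := v) (d := d)
        { hs with link_w := hx, far_w := hxc, link_y := hv, far_y := hva } hxd ?_
      exact ⟨hne x v hx hv hxc hva, hn⟩
    have hwdQ : Indep G (insert d (insert w Q)) :=
      (hs.indep.insert hs.link_w).insert (link_insert.2 ⟨hwd, hs.link_d⟩)
    obtain ⟨w', hw', hw'c⟩ := h.exists_link_far hwdQ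
      (by have := Finset.card_insert_le d (insert w Q)
          have := Finset.card_insert_le w Q
          omega) (Finset.mem_insert_of_mem (Finset.mem_insert_self w Q)) hs.far_w
      (Finset.mem_insert_of_mem (Finset.mem_insert_of_mem hs.mem)) hbc
    rw [link_insert, link_insert] at hw'
    obtain ⟨hdw', hww', hw'Q⟩ := hw'
    obtain ⟨u, hu, hwu⟩ := h.exists_adj (insert w' Q) w (hs.indep.insert hw'Q)
      (link_insert.2 ⟨hww'.symm, hs.link_w⟩)
    rw [link_insert] at hu
    refine full hs w u hs.link_w hu.2 (hadj w hs.link_w hs.far_w hwd) fun v hv hva => ⟨?_, ?_⟩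
    · rintro rfl
      exact hu.1.2 (hadj w' hw'Q hw'c hdw'.symm u hv hva)
    · intro huv
      exact h.not_triangle b w u v (hs.link_w b hs.mem) (hu.2 b hs.mem) (hv b hs.mem) hwu huv
        (hadj w hs.link_w hs.far_w hwd v hv hva)
  have hne : ∀ {a c w y d}, Separated G Q a b c w y d → G.Adj d w := by
    intro a c w y d hs
    by_contra hn
    refine main hs (far_comm.1 ⟨?_, hn⟩)
    rintro rfl
    exact hs.not_far_right hs.far_w
  have hdA : ∀ v, Link G Q v → Far G v a → G.Adj d v := fun v hv hva =>
    hne (a := c) (c := a) (w := v) (y := w) { hs.symm with link_w := hv, far_w := hva }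
  refine full hs d w hs.link_d hs.link_w hdA fun v hv hva => ⟨?_, fun hwv => ?_⟩
  · rintro rfl
    exact hs.not_far w hv hva hs.far_w
  · exact h.not_triangle b d w v (hs.link_d b hs.mem) (hs.link_w b hs.mem) (hv b hs.mem)
      (hne hs) hwv (hdA v hv hva)

end IsLTFW2

namespace IsLTFW2

variable {G : SimpleGraph V} {n : ℕ}

/-- If `a`, `b` are adjacent vertices dominating the graph, `x` is not adjacent to `a`, then the
vertices adjacent to neither `x` nor `b`, if any, form a maximum independent set of `G \ N[x]`. -/
theorem exists_common_far [Fintype V] (h : IsLTFW2 G n) {a b x y : V} (hab : G.Adj a b)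
    (hno : ∀ z, Far G a z → ¬ Far G b z) (hax : Far G a x) (hby : Far G b y) (hxy : Far G x y) :
    ∃ S : Finset V, (∀ v, v ∈ S ↔ Far G x v ∧ Far G b v) ∧ Indep G S ∧ S.card + 1 = n := by
  classical
  have hS : ∀ v, v ∈ Finset.univ.filter (fun v => Far G x v ∧ Far G b v) ↔
      Far G x v ∧ Far G b v := fun v => by simp
  set S := Finset.univ.filter (fun v => Far G x v ∧ Far G b v)
  have hadj : ∀ v, Far G b v → G.Adj a v := fun v hv => by
    by_contra hn
    refine hno v ⟨?_, hn⟩ hv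
    rintro rfl
    exact hv.2 hab.symm
  have hind : Indep G S := fun u hu v hv huv =>
    h.not_triangle x a u v hax.symm ((hS u).1 hu).1 ((hS v).1 hv).1
      (hadj u ((hS u).1 hu).2) huv (hadj v ((hS v).1 hv).2)
  have hlink : Link G S x := fun s hs => ((hS s).1 hs).1.symm
  have hT : Indep G ({x} ∪ S) := by
    rw [← Finset.insert_eq]
    exact hind.insert hlink
  have hcard := h.card_eq_of_indep (c := b) (s := x) (i := y) hT (Finset.mem_singleton_self x)
    (fun h' => hno x hax h'.symm) (Finset.mem_union_right _ ((hS y).2 ⟨hxy, hby⟩)) hby.symm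
    fun v hv hvb => (hS v).2 ⟨hv x (Finset.mem_singleton_self x), hvb.symm⟩
  rw [← Finset.insert_eq, Finset.card_insert_of_notMem hlink.notMem] at hcard
  exact ⟨S, hS, hind, hcard⟩

theorem exists_flip [Fintype V] (h : IsLTFW2 G n) (hn : 3 ≤ n) {a b x y : V} (hab : G.Adj a b)
    (hno : ∀ z, Far G a z → ¬ Far G b z) (hax : Far G a x) (hby : Far G b y) (hxy : Far G x y) :
    ∃ w, Far G a w ∧ Far G x w ∧ G.Adj w y ∧ ∀ z, z ≠ y → Far G x z → Far G b z → Far G w z := by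
  classical
  obtain ⟨S, hS, hind, hcard⟩ := h.exists_common_far hab hno hax hby hxy
  have hyS : y ∈ S := (hS y).2 ⟨hxy, hby⟩
  have hlink : Link G (S.erase y) x := fun s hs => ((hS s).1 (Finset.mem_of_mem_erase hs)).1.symm
  have hT : Indep G (insert x (S.erase y)) :=
    (hind.mono (Finset.erase_subset y S)).insert hlink
  obtain ⟨w, hw, hyw⟩ := h.exists_adj _ y hT (link_insert.2 ⟨hxy, fun s hs =>
    ⟨Finset.ne_of_mem_erase hs, hind s (Finset.mem_of_mem_erase hs) y hyS⟩⟩)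
  rw [link_insert] at hw
  have hwz : ∀ z, z ≠ y → Far G x z → Far G b z → Far G w z := fun z hzy hxz hbz =>
    (hw.2 z (Finset.mem_erase.2 ⟨hzy, (hS z).2 ⟨hxz, hbz⟩⟩)).symm
  refine ⟨w, ⟨?_, fun haw => ?_⟩, hw.1, hyw.symm, hwz⟩
  · rintro rfl
    obtain ⟨z, hz, hzy⟩ := Finset.exists_mem_ne (by omega : 1 < S.card) y
    have := (hS z).1 hz
    exact hno z (hwz z hzy this.1 this.2) this.2
  · have hay : G.Adj a y := by
      by_contra hn'
      refine hno y ⟨?_, hn'⟩ hby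
      rintro rfl
      exact hby.2 hab.symm
    exact h.not_triangle x a y w hax.symm hxy hw.1 hay hyw haw

theorem exists_far_far_of_four_le [Fintype V] (h : IsLTFW2 G n) (hn : 4 ≤ n) {a b x y : V}
    (hab : G.Adj a b) (hax : Far G a x) (hby : Far G b y) (hxy : Far G x y) :
    ∃ z, Far G a z ∧ Far G b z := by
  classical
  by_contra! hno
  obtain ⟨S, hS, hind, hcard⟩ := h.exists_common_far hab hno hax hby hxy
  have hflip : ∀ s, s ∈ S → ∃ w, Far G a w ∧ Far G x w ∧ G.Adj w s ∧
      ∀ z, z ≠ s → Far G x z → Far G b z → Far G w z := fun s hs =>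
    h.exists_flip (by omega) hab hno hax ((hS s).1 hs).2 ((hS s).1 hs).1
  choose! f hfa hfx hfs hfz using hflip
  have hbadj : ∀ w, Far G a w → G.Adj b w := fun w hw => by
    by_contra hn'
    refine hno w hw ⟨?_, hn'⟩
    rintro rfl
    exact hw.2 hab
  have hnadj : ∀ s ∈ S, ∀ t ∈ S, ¬ G.Adj (f s) (f t) := fun s hs t ht hst => by
    obtain ⟨z, hz⟩ : (S \ {s, t}).Nonempty := by
      rw [← Finset.card_pos]
      have := Finset.le_card_sdiff {s, t} S
      have := Finset.card_le_two (a := s) (b := t)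
      omega
    simp only [Finset.mem_sdiff, Finset.mem_insert, Finset.mem_singleton, not_or, hS] at hz
    exact h.not_triangle z b (f s) (f t) hz.1.2.symm (hfz s hs z hz.2.1 hz.1.1 hz.1.2).symm
      (hfz t ht z hz.2.2 hz.1.1 hz.1.2).symm (hbadj _ (hfa s hs)) hst (hbadj _ (hfa t ht))
  have hinj : Set.InjOn f S := fun s hs t ht hst => by
    by_contra hne
    have := hfz s hs t (Ne.symm hne) ((hS t).1 ht).1 ((hS t).1 ht).2
    exact this.2 (hst ▸ hfs t ht)
  have hW : Indep G (S.image f) := by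
    simpa [Indep] using hnadj
  have hWx : Link G (S.image f) x := by
    simpa [Link] using fun s hs => (hfx s hs).symm
  have hWa : Link G (insert x (S.image f)) a := by
    rw [link_insert]
    exact ⟨hax.symm, by simpa [Link] using fun s hs => (hfa s hs).symm⟩
  have := h.card_le _ ((hW.insert hWx).insert hWa)
  rw [Finset.card_insert_of_notMem hWa.notMem, Finset.card_insert_of_notMem hWx.notMem,
    Finset.card_image_of_injOn hinj] at this
  omega

end IsLTFW2

/-- If the complement is connected of diameter greater than two, then it has
a geodesic path of length three. -/
theorem exists_geodesic_of_not_isJoin {G : SimpleGraph V} (hjoin : ¬ IsJoin G) {a b : V}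
    (hab : G.Adj a b) (hno : ∀ z, Far G a z → ¬ Far G b z) :
    ∃ b' x y, G.Adj a b' ∧ (∀ z, Far G a z → ¬ Far G b' z) ∧ Far G a x ∧ Far G b' y ∧
      Far G x y := by
  by_contra! hcon
  have hU := eq_univ_of_not_isJoin hjoin
    (U := {v | v = a ∨ Far G a v ∨ ∃ x, Far G a x ∧ Far G x v}) (u := a) (Or.inl rfl) ?_
  · rcases (hU ▸ mem_univ b : b ∈ {v | v = a ∨ Far G a v ∨ ∃ x, Far G a x ∧ Far G x v}) with
      h | h | ⟨x, hax, hxb⟩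
    · exact hab.ne h.symm
    · exact h.2 hab
    · exact hno x hax hxb.symm
  · rintro u (rfl | hu | ⟨x, hax, hxu⟩) v huv
    · exact Or.inr (Or.inl huv)
    · exact Or.inr (Or.inr ⟨u, hu, huv⟩)
    · by_contra hv
      rw [mem_ofPred_eq, not_or, not_or] at hv
      refine hcon v x u ?_ (fun z haz hvz => hv.2.2 ⟨z, haz, hvz.symm⟩) hax huv.symm hxu
      by_contra hav
      exact hv.2.1 ⟨fun h => hv.1 h.symm, hav⟩

theorem IsLTFW2.exists_far_far [Fintype V] {G : SimpleGraph V} {n : ℕ} (h : IsLTFW2 G n)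
    (hn : 4 ≤ n) (hjoin : ¬ IsJoin G) {a b : V} (hab : G.Adj a b) :
    ∃ z, Far G a z ∧ Far G b z := by
  by_contra! hno
  obtain ⟨b', x, y, hab', hno', hax, hby, hxy⟩ := exists_geodesic_of_not_isJoin hjoin hab hno
  obtain ⟨z, hz⟩ := h.exists_far_far_of_four_le hn hab' hax hby hxy
  exact hno' z hz.1 hz.2

namespace IsLTFW2

variable {G : SimpleGraph V} {n : ℕ}

theorem adj_of_far (h : IsLTFW2 G 3) {x p q r : V} (hxp : Far G x p) (hxq : Far G x q)
    (hxr : Far G x r) (hpq : Far G p q) (hpr : Far G p r) (hqr : q ≠ r) : G.Adj q r := by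
  classical
  refine h.adj_of_link (T := {x, p}) ?_ (by rw [Finset.card_pair hxp.1]) ?_ ?_ hqr
  · simp [Indep, hxp.2, hxp.symm.2]
  · simp [Link, hxq, hpq]
  · simp [Link, hxr, hpr]

theorem eq_or_eq_of_far (h : IsLTFW2 G 3) {x p q r t : V} (hxp : Far G x p) (hxq : Far G x q)
    (hxr : Far G x r) (hxt : Far G x t) (hpq : Far G p q) (hpr : Far G p r) (hpt : Far G p t)
    (hqr : q ≠ r) : t = q ∨ t = r := by
  by_contra! hne
  exact h.not_triangle x q r t hxq hxr hxt (h.adj_of_far hxp hxq hxr hpq hpr hqr)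
    (h.adj_of_far hxp hxr hxt hpr hpt hne.2.symm) (h.adj_of_far hxp hxq hxt hpq hpt hne.1.symm)

theorem exists_far_of_far (h : IsLTFW2 G 3) {i s c : V} (his : Far G i s) (hic : Far G i c)
    (hsc : ¬ Far G s c) : ∃ v, Far G i v ∧ Far G s v ∧ Far G c v := by
  classical
  obtain ⟨v, hv, hvc⟩ := h.exists_link_far (T := {i, s}) (i := i) (s := s) (c := c)
    (by simp [Indep, his.2, his.symm.2]) (by rw [Finset.card_pair his.1]; omega) (by simp) hic
    (by simp) hsc
  exact ⟨v, hv i (by simp), hv s (by simp), hvc.symm⟩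

/-- A pentagon in the complement of `G \ N[x]` contains all vertices of `G \ N[x]`. -/
theorem mem_pentagon (h : IsLTFW2 G 3) {x p q r s t z : V} (hp : Far G x p) (hq : Far G x q)
    (hr : Far G x r) (hs : Far G x s) (ht : Far G x t) (hpq : Far G p q) (hqr : Far G q r)
    (hrs : Far G r s) (htp : Far G t p) (hpr : p ≠ r) (hqs : q ≠ s)
    (htq : t ≠ q) (hz : Far G x z) : z = p ∨ z = q ∨ z = r ∨ z = s ∨ z = t := by
  by_contra! hne
  have hzp : G.Adj z p := by
    by_contra hn
    have := h.eq_or_eq_of_far hp hq ht hz hpq htp.symm ⟨hne.1.symm, fun h' => hn h'.symm⟩ htq.symm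
    tauto
  have hzr : G.Adj z r := by
    by_contra hn
    have := h.eq_or_eq_of_far hr hq hs hz hqr.symm hrs
      ⟨hne.2.2.1.symm, fun h' => hn h'.symm⟩ hqs
    tauto
  exact h.not_triangle x z p r hz hp hr hzp (h.adj_of_far hq hp hr hpq.symm hqr hpr) hzr

/-- Two disjoint pairs of non-adjacent vertices and a fifth vertex of `G \ N[x]`
induce a pentagon. -/
theorem exists_pentagon (h : IsLTFW2 G 3) {x p p' q q' d : V} (hp : Far G x p) (hp' : Far G x p')
    (hq : Far G x q) (hq' : Far G x q') (hd : Far G x d) (hpp : Far G p p') (hqq : Far G q q')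
    (h1 : p ≠ q) (h2 : p ≠ q') (h3 : p' ≠ q) (h4 : p' ≠ q') (hdp : d ≠ p) (hdp' : d ≠ p')
    (hdq : d ≠ q) (hdq' : d ≠ q') :
    ∃ r r' s s', (r = p ∧ r' = p' ∨ r = p' ∧ r' = p) ∧ (s = q ∧ s' = q' ∨ s = q' ∧ s' = q) ∧
      Far G d r ∧ Far G r r' ∧ Far G r' s' ∧ Far G s' s ∧ Far G s d ∧
      G.Adj d r' ∧ G.Adj d s' ∧ G.Adj r s ∧ G.Adj r s' ∧ G.Adj r' s := by
  have tri : ∀ y z w, Far G x y → Far G x z → Far G x w → G.Adj y z → G.Adj z w → ¬ G.Adj y w :=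
    fun y z w hy hz hw h1 h2 h3 => h.not_triangle x y z w hy hz hw h1 h2 h3
  have ktri : ∀ y z w, Far G x y → Far G x z → Far G x w → Far G y z → Far G z w →
      ¬ Far G y w := fun y z w hy hz hw h1 h2 h3 =>
    h2.2 (h.adj_of_far hy hz hw h1 h3 h2.1)
  have t1 := ktri d p p' hd hp hp'
  have t2 := ktri d q q' hd hq hq'
  have u1 := ktri p q q' hp hq hq'
  have u2 := ktri p' q q' hp' hq hq'
  have u3 := ktri q p p' hq hp hp'
  have u4 := ktri q' p p' hq' hp hp'
  have v1 := ktri d p q hd hp hq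
  have v2 := ktri d p q' hd hp hq'
  have v3 := ktri d p' q hd hp' hq
  have v4 := ktri d p' q' hd hp' hq'
  have w1 := tri d p q hd hp hq
  have w2 := tri d p q' hd hp hq'
  have w3 := tri d p' q hd hp' hq
  have w4 := tri d p' q' hd hp' hq'
  have s := fun y z => G.adj_comm y z
  by_cases c1 : G.Adj d p <;> by_cases c2 : G.Adj d q
  · exact ⟨p', p, q', q, by grind [Far]⟩
  · exact ⟨p', p, q, q', by grind [Far]⟩
  · exact ⟨p, p', q', q, by grind [Far]⟩
  · exact ⟨p, p', q, q', by grind [Far]⟩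

end IsLTFW2

theorem adj_of_not_far {G : SimpleGraph V} {x y : V} (h : ¬ Far G x y) (hxy : x ≠ y) :
    G.Adj x y := by
  by_contra h'
  exact h ⟨hxy, h'⟩

/-- Any two adjacent vertices have a common non-neighbour. -/
def CommonFar (G : SimpleGraph V) : Prop := ∀ x y, G.Adj x y → ∃ z, Far G x z ∧ Far G y z

namespace IsLTFW2

variable {G : SimpleGraph V} {n : ℕ}

theorem not_adj_adj_far_of_three (h : IsLTFW2 G 3) (hdiam : CommonFar G) {a b c d : V}
    (hab : G.Adj a b) (hbc : G.Adj b c) (hac : G.Adj a c) (hdb : Far G d b) (hda : G.Adj d a)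
    (hdc : G.Adj d c) : False := by
  obtain ⟨a₁, hba, hca⟩ := hdiam b c hbc
  obtain ⟨a₂, haa, hba', hca'⟩ := h.exists_far_of_far hba.symm hca.symm fun h' => h'.2 hbc
  obtain ⟨c₁, hbc₁, hac₁⟩ := hdiam b a hab.symm
  obtain ⟨c₂, hcc, hbc₂, hac₂⟩ := h.exists_far_of_far hbc₁.symm hac₁.symm fun h' => h'.2 hab.symm
  have hsymm := G.adj_comm
  have hA : ∀ {x}, Far G b x → Far G c x → G.Adj a x := fun hb hc =>
    adj_of_not_far (fun ha => h.not_triangle _ a b c ha.symm hb.symm hc.symm hab hbc hac)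
      (by rintro rfl; exact hb.2 hab.symm)
  have hC : ∀ {x}, Far G b x → Far G a x → G.Adj c x := fun hb ha =>
    adj_of_not_far (fun hc => h.not_triangle _ a b c ha.symm hb.symm hc.symm hab hbc hac)
      (by rintro rfl; exact hb.2 hbc)
  have hB : ∀ {x}, Far G a x → Far G c x → G.Adj b x := fun ha hc =>
    adj_of_not_far (fun hb => h.not_triangle _ a b c ha.symm hb.symm hc.symm hab hbc hac)
      (by rintro rfl; exact ha.2 hab)
  have hD : ∀ {x}, Far G a x → Far G c x → G.Adj d x := fun ha hc =>
    adj_of_not_far (fun hd => h.not_triangle _ a c d ha.symm hc.symm hd.symm hac hdc.symm hda.symm)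
      (by rintro rfl; exact ha.2 hda.symm)
  have ne : ∀ {x y z}, G.Adj x y → Far G x z → y ≠ z := fun h1 h2 => by
    rintro rfl; exact h2.2 h1
  obtain ⟨r, r', s, s', hr, hs, hdr, hrr, -, hss, hsd, hdr', hds', -, -, -⟩ :=
    h.exists_pentagon hba hba' hbc₁ hbc₂ hdb.symm haa hcc (ne (hA hba hca) hac₁)
      (ne (hA hba hca) hac₂) (ne (hA hba' hca') hac₁) (ne (hA hba' hca') hac₂)
      (ne hdc.symm hca) (ne hdc.symm hca') (ne hda.symm hac₁) (ne hda.symm hac₂)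
  have hbr : Far G b r := by grind
  have hcr : Far G c r := by grind
  have hbr' : Far G b r' := by grind
  have hcr' : Far G c r' := by grind
  have hbs : Far G b s := by grind
  have has : Far G a s := by grind
  have hbs' : Far G b s' := by grind
  have has' : Far G a s' := by grind
  clear hba hca haa hba' hca' hbc₁ hac₁ hcc hbc₂ hac₂ hr hs a₁ a₂ c₁ c₂
  have har := hA hbr hcr
  have har' := hA hbr' hcr'
  have hcs := hC hbs has
  have hcs' := hC hbs' has'
  obtain ⟨u, hru, hdu, hcu⟩ := h.exists_far_of_far hdr.symm hcr.symm fun h' => h'.2 hdc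
  obtain ⟨v, hsv, hdv, hav⟩ := h.exists_far_of_far hsd has.symm fun h' => h'.2 hda
  have hau : G.Adj a u := adj_of_not_far
    (fun hau => h.not_triangle u a c d hau.symm hcu.symm hdu.symm hac hdc.symm hda.symm)
    (ne hda hdu)
  have hcv : G.Adj c v := adj_of_not_far
    (fun hcv => h.not_triangle v a c d hav.symm hcv.symm hdv.symm hac hdc.symm hda.symm)
    (ne hdc hdv)
  have hbu : G.Adj b u := h.adj_of_far hdr hdb hdu hbr.symm hru (ne hbc.symm hcu)
  have hbv : G.Adj b v := h.adj_of_far hsd.symm hdb hdv hbs.symm hsv (ne hab hav)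
  have huv : Far G u v := ⟨ne hau hav, fun huv => h.not_triangle d b u v hdb hdu hdv hbu huv hbv⟩
  obtain ⟨e₁, hae, hce⟩ := hdiam a c hac
  obtain ⟨e₂, hee, hae', hce'⟩ := h.exists_far_of_far hae.symm hce.symm fun h' => h'.2 hac
  obtain ⟨t, t', e, e', ht, he, hut, -, -, hee', heu, hut', hue', hte, hte', -⟩ :=
    h.exists_pentagon hcr hcr' hce hce' hcu hrr hee (ne har hae) (ne har hae') (ne har' hae)
      (ne har' hae') hru.1.symm (ne hdr' hdu).symm (ne (hD hae hce) hdu).symm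
      (ne (hD hae' hce') hdu).symm
  obtain ⟨rfl, rfl⟩ : t = r ∧ t' = r' := by
    rcases ht with ht | ⟨rfl, rfl⟩
    · exact ht
    · exact absurd hut' hru.symm.2
  have hae : Far G a e := by grind
  have hae' : Far G a e' := by grind
  have hce : Far G c e := by grind
  have hce' : Far G c e' := by grind
  have hde := hD hae hce
  have hde' := hD hae' hce'
  have hbe := hB hae' hce'
  have hvr : G.Adj v t := h.adj_of_far hdu hdv hdr huv hru.symm (ne hcv hcr)
  have hve : Far G e v := ⟨ne hde hdv,
    fun hev => h.not_triangle u v t e huv hut heu.symm hvr hte hev.symm⟩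
  have hve' : G.Adj v e' := h.adj_of_far hae hav hae' hve hee'.symm (ne hde' hdv).symm
  have hse' : G.Adj s e' := by
    by_contra hn
    rcases h.eq_or_eq_of_far has hav has' hae' hsv hss.symm ⟨ne hcs hce', hn⟩ (ne hbv hbs')
      with rfl | rfl
    · exact hve'.ne rfl
    · exact hce'.2 hcs'
  obtain ⟨z, hdz, hez⟩ := hdiam d e' hde'
  rcases h.mem_pentagon hdb hdr hdu hdv hsd.symm hbr hru huv hbs.symm hbu.ne
    (ne hcv hcr).symm (ne hcs hcr) hdz with rfl | rfl | rfl | rfl | rfl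
  · exact hez.2 hbe.symm
  · exact hez.2 hte'.symm
  · exact hez.2 hue'.symm
  · exact hez.2 hve'.symm
  · exact hez.2 hse'.symm

theorem not_adj_adj_far (h : IsLTFW2 G n) (hn : 3 ≤ n) (hdiam : CommonFar G) {a b c d : V}
    (hab : G.Adj a b) (hbc : G.Adj b c) (hac : G.Adj a c) (hdb : Far G d b) (hda : G.Adj d a)
    (hdc : G.Adj d c) : False := by
  classical
  rcases hn.eq_or_lt with rfl | hn
  · exact h.not_adj_adj_far_of_three hdiam hab hbc hac hdb hda hdc
  obtain ⟨w, hbw, hcw⟩ := hdiam b c hbc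
  obtain ⟨y, hay, hby⟩ := hdiam a b hab
  refine h.not_separated (Q := {b}) (a := a) (b := b) (c := c) (w := w) (y := y) (d := d)
    { indep := by simp [Indep]
      mem := Finset.mem_singleton_self b
      adj_left := hab.symm
      adj_right := hbc
      not_far := fun v hv ha hc =>
        h.not_triangle v a b c ha (hv b (Finset.mem_singleton_self b)).symm hc hab hbc hac
      link_w := by simpa [Link] using hbw
      far_w := hcw.symm
      link_y := by simpa [Link] using hby
      far_y := hay.symm
      link_d := by simpa [Link] using hdb.symm
      not_far_left := fun h' => h'.2 hda
      not_far_right := fun h' => h'.2 hdc } ?_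
  rwa [Finset.card_singleton, add_comm]

/-- Every vertex outside a triangle is adjacent to exactly one vertex of the triangle. -/
theorem adj_far_far_or (h : IsLTFW2 G n) (hn : 3 ≤ n) (hdiam : CommonFar G) {a b c v : V}
    (hab : G.Adj a b) (hbc : G.Adj b c) (hac : G.Adj a c) (hva : v ≠ a) (hvb : v ≠ b)
    (hvc : v ≠ c) :
    (G.Adj a v ∧ Far G b v ∧ Far G c v) ∨ (Far G a v ∧ G.Adj b v ∧ Far G c v) ∨
      (Far G a v ∧ Far G b v ∧ G.Adj c v) := by
  have h0 : ∀ v, Far G v a → Far G v b → ¬ Far G v c := fun v ha hb hc =>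
    h.not_triangle v a b c ha hb hc hab hbc hac
  have h1 : ∀ v, Far G v a → G.Adj v b → ¬ G.Adj v c := fun v ha hb hc =>
    h.not_adj_adj_far hn hdiam hab.symm hac hbc ha hb hc
  have h2 : ∀ v, Far G v b → G.Adj v a → ¬ G.Adj v c := fun v hb ha hc =>
    h.not_adj_adj_far hn hdiam hab hbc hac hb ha hc
  have h3 : ∀ v, Far G v c → G.Adj v a → ¬ G.Adj v b := fun v hc ha hb =>
    h.not_adj_adj_far hn hdiam hac hbc.symm hab hc ha hb
  have key : ¬ (G.Adj v a ∧ G.Adj v b ∧ G.Adj v c) := fun ⟨ha, hb, hc⟩ => by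
    obtain ⟨z, hvz, haz⟩ := hdiam v a ha
    have hzb : ¬ Far G z b := fun hzb =>
      h.not_triangle z a b v haz.symm hzb hvz.symm hab hb.symm ha.symm
    have hzc : ¬ Far G z c := fun hzc =>
      h.not_triangle z a c v haz.symm hzc hvz.symm hac hc.symm ha.symm
    refine h1 z haz.symm (adj_of_not_far hzb ?_) (adj_of_not_far hzc ?_)
    · rintro rfl
      exact hvz.2 hb
    · rintro rfl
      exact hvz.2 hc
  have e1 := h0 v
  have e2 := h1 v
  have e3 := h2 v
  have e4 := h3 v
  simp only [Far, ne_eq, hva, hvb, hvc, hva.symm, hvb.symm, hvc.symm, not_false_eq_true,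
    true_and, G.adj_comm a v, G.adj_comm b v, G.adj_comm c v] at *
  tauto

end IsLTFW2

/-- The vertices adjacent to the vertex `a` of a triangle `a`, `b`, `c` and to no other. -/
def Side (G : SimpleGraph V) (a b c v : V) : Prop := G.Adj a v ∧ Far G b v ∧ Far G c v

theorem Side.swap {G : SimpleGraph V} {a b c v : V} (h : Side G a b c v) : Side G a c b v :=
  ⟨h.1, h.2.2, h.2.1⟩

/-- A triangle in a locally triangle-free graph in `W₂` in which any two adjacent vertices have a
common non-neighbour. -/
structure HasTriangle (G : SimpleGraph V) (n : ℕ) (a b c : V) : Prop extends IsLTFW2 G n where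
  three_le : 3 ≤ n
  commonFar : CommonFar G
  adj_ab : G.Adj a b
  adj_bc : G.Adj b c
  adj_ac : G.Adj a c

namespace HasTriangle

variable {G : SimpleGraph V} {n : ℕ} {a b c : V}

theorem rot (h : HasTriangle G n a b c) : HasTriangle G n b c a :=
  { h with adj_ab := h.adj_bc, adj_bc := h.adj_ac.symm, adj_ac := h.adj_ab.symm }

theorem swap (h : HasTriangle G n a b c) : HasTriangle G n a c b :=
  { h with adj_ab := h.adj_ac, adj_bc := h.adj_bc.symm, adj_ac := h.adj_ab }

theorem side_of_far (h : HasTriangle G n a b c) {v : V} (hb : Far G b v) (hc : Far G c v) :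
    Side G a b c v := by
  refine ⟨adj_of_not_far (fun ha => ?_) ?_, hb, hc⟩
  · exact h.not_triangle v a b c ha.symm hb.symm hc.symm h.adj_ab h.adj_bc h.adj_ac
  · rintro rfl
    exact hb.2 h.adj_ab.symm

theorem side_or (h : HasTriangle G n a b c) {v : V} (ha : v ≠ a) (hb : v ≠ b) (hc : v ≠ c) :
    Side G a b c v ∨ Side G b c a v ∨ Side G c a b v := by
  rcases h.adj_far_far_or h.three_le h.commonFar h.adj_ab h.adj_bc h.adj_ac ha hb hc with
    h | h | h
  · exact Or.inl h
  · exact Or.inr (Or.inl ⟨h.2.1, h.2.2, h.1⟩)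
  · exact Or.inr (Or.inr ⟨h.2.2, h.1, h.2.1⟩)

theorem side_or_of_far (h : HasTriangle G n a b c) {v : V} (hv : Far G a v) :
    Side G b c a v ∨ Side G c a b v := by
  refine (h.side_or (v := v) hv.1.symm ?_ ?_).resolve_left fun h' => hv.2 h'.1
  · rintro rfl
    exact hv.2 h.adj_ab
  · rintro rfl
    exact hv.2 h.adj_ac

theorem adj_iff (h : HasTriangle G n a b c) {v : V} (hv : Far G a v) :
    G.Adj b v ↔ ¬ G.Adj c v := by
  rcases h.side_or_of_far hv with h' | h'
  · exact ⟨fun _ => h'.2.1.2, fun _ => h'.1⟩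
  · exact ⟨fun hb => absurd hb h'.2.2.2, fun hc => absurd h'.1 hc⟩

theorem far_of_not_adj (h : HasTriangle G n a b c) {v : V} (hv : Far G a v)
    (hc : ¬ G.Adj b v) : Far G b v := by
  refine ⟨?_, hc⟩
  rintro rfl
  exact hv.2 h.adj_ab

theorem far_of_adj (h : HasTriangle G n a b c) {v : V} (hv : G.Adj a v) (hb : v ≠ b)
    (hc : v ≠ c) : Far G b v := by
  rcases h.side_or (v := v) hv.ne' hb hc with h' | h' | h'
  · exact h'.2.1
  · exact absurd hv h'.2.2.2
  · exact absurd hv h'.2.1.2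

theorem of_adj (h : HasTriangle G n a b c) {y y' : V} (hy : G.Adj a y) (hy' : G.Adj a y')
    (hyy : G.Adj y y') : HasTriangle G n a y y' :=
  { h with adj_ab := hy, adj_bc := hyy, adj_ac := hy' }

theorem exists_side (h : HasTriangle G n a b c) : ∃ v, Side G a b c v := by
  obtain ⟨v, hb, hc⟩ := h.commonFar b c h.adj_bc
  exact ⟨v, h.side_of_far hb hc⟩

/-- Each vertex `z` of the side of `c` is adjacent to exactly one of the isolated vertices of the
side of `a`. -/
theorem exists_isolated_of_far (h : HasTriangle G n a b c) {y z : V} (hy : Side G a b c y)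
    (hz : Side G c a b z) (hyz : Far G y z) :
    ∃ r, Side G a b c r ∧ G.Adj r z ∧ (∀ x, Side G a b c x → x ≠ r → Far G r x) ∧
      ∀ r', Side G a b c r' → (∀ x, Side G a b c x → x ≠ r' → Far G r' x) → G.Adj r' z →
        r' = r := by
  classical
  have hbc : ¬ Far G b c := fun h' => h'.2 h.adj_bc
  have hT : Indep G {b, y} := by
    simp [Indep, hy.2.1.2, hy.2.1.symm.2]
  have hzT : Link G {b, y} z := by simp [Link, hz.2.2, hyz]
  obtain ⟨S, hS, hdisj, hcard, hfar⟩ := h.exists_superset_far (T := insert z {b, y}) (c := c)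
    (i := y) (s := b) (hT.insert hzT) (by simp) hy.2.2.symm (by simp) hbc
  set T := {b, y} ∪ S with hTdef
  have hins : insert z {b, y} ∪ S = insert z T := by rw [hTdef, Finset.insert_union]
  rw [hins] at hS hcard
  have hzT : z ∉ T := by
    intro hz'
    rcases Finset.mem_union.1 hz' with h' | h'
    · exact hzT.notMem h'
    · exact Finset.disjoint_left.1 hdisj (Finset.mem_insert_self z _) h'
  have hlz : Link G T z := fun t ht => ⟨fun h' => hzT (h' ▸ ht),
    hS t (Finset.mem_insert_of_mem ht) z (Finset.mem_insert_self z T)⟩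
  have hTi : Indep G T := hS.mono (Finset.subset_insert z T)
  have hTc : T.card + 1 = n := by rw [← hcard, Finset.card_insert_of_notMem hzT]
  have hbT : b ∈ T := by simp [hTdef]
  have hyT : y ∈ T := by simp [hTdef]
  have hside : ∀ t ∈ T, t ≠ b → Side G a b c t := by
    intro t ht htb
    have hbt : Far G b t := ⟨htb.symm, hTi b hbT t ht⟩
    rcases Finset.mem_union.1 ht with h' | h'
    · rcases Finset.mem_insert.1 h' with h' | h'
      · exact absurd h' htb
      · exact (Finset.mem_singleton.1 h') ▸ hy
    · exact h.side_of_far hbt (hfar t h').symm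
  obtain ⟨r, hr, hrc⟩ := h.exists_link_far hTi (by omega) hyT hy.2.2.symm hbT hbc
  have hrs : Side G a b c r := h.side_of_far (hr b hbT) hrc.symm
  have hrz : r ≠ z := by
    rintro rfl
    exact hrc.symm.2 hz.1
  have hlink : ∀ x, Side G a b c x → Link G T x → x = r := fun x hx hl => by
    rcases h.eq_or_eq_of_link hTi hbT (by omega) hr hlz hl hrz with h' | h'
    · exact h'
    · exact absurd hz.1 (h' ▸ hx.2.2.2)
  refine ⟨r, hrs, h.adj_of_link hTi (by omega) hr hlz hrz, fun x hx hxr => ?_,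
    fun r' hr' hiso hadj => hlink r' hr' fun t ht => ?_⟩
  · by_contra hrx
    have hadj := adj_of_not_far hrx hxr.symm
    refine hxr (hlink x hx fun t ht => ?_)
    by_cases htb : t = b
    · exact htb ▸ hx.2.1
    · refine ((h.of_adj hx.1 hrs.1 hadj.symm).far_of_adj (hside t ht htb).1 ?_ (hr t ht).1).symm
      rintro rfl
      exact (hr t ht).2 hadj.symm
  · by_cases htb : t = b
    · exact htb ▸ hr'.2.1
    · refine (hiso t (hside t ht htb) ?_).symm
      rintro rfl
      exact (hlz t ht).2 hadj

theorem card_far_side (h : HasTriangle G n a b c) {y z : V} {S : Finset V} (hy : Side G a b c y)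
    (hS : ∀ v, v ∈ S ↔ Side G c a b v ∧ Far G y v) (hind : Indep G S) (hz : z ∈ S) :
    S.card + 2 = n := by
  classical
  have hl : ∀ v ∈ S, Link G {b, y} v := fun v hv => by
    simp [Link, ((hS v).1 hv).2, ((hS v).1 hv).1.2.2]
  have hI : Indep G ({b, y} ∪ S) := by
    intro u hu v hv
    rcases Finset.mem_union.1 hu with hu | hu <;> rcases Finset.mem_union.1 hv with hv | hv
    · have : Indep G {b, y} := by simp [Indep, hy.2.1.2, hy.2.1.symm.2]
      exact this u hu v hv
    · exact (hl v hv u hu).2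
    · exact (hl u hu v hv).symm.2
    · exact hind u hu v hv
  have hcard := h.card_eq_of_indep (c := a) (s := b) (i := z) hI (by simp)
    (fun h' => h'.2 h.adj_ab.symm) (Finset.mem_union_right _ hz) ((hS z).1 hz).1.2.1.symm
    fun v hv hva => (hS v).2 ⟨h.rot.rot.side_of_far hva.symm (hv b (by simp)), hv y (by simp)⟩
  rw [← hcard, Finset.card_union_of_disjoint, Finset.card_pair hy.2.1.1, add_comm]
  rw [Finset.disjoint_right]
  exact fun v hv => (hl v hv).notMem

end HasTriangle

theorem side_comm (G : SimpleGraph V) (a b c : V) : Side G a b c = Side G a c b :=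
  funext fun _ => propext ⟨Side.swap, Side.swap⟩

namespace HasTriangle

variable {G : SimpleGraph V} {n : ℕ} {a b c : V}

theorem exists_far_side [Finite V] (h : HasTriangle G n a b c) {y y' : V} (hy : Side G a b c y)
    (hy' : Side G a b c y') (hyy : G.Adj y y') : ∃ z, Side G c a b z ∧ Far G y z := by
  classical
  cases nonempty_fintype V
  by_contra! hno
  have hadj : ∀ z, Side G c a b z → G.Adj y z := fun z hz => adj_of_not_far (hno z hz) (by
    rintro rfl
    exact hz.2.1.2 hy.1)
  have hmem : ∀ z, z ∈ Finset.univ.filter (Side G c a b) ↔ Side G c a b z := fun z => by simp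
  set S := Finset.univ.filter (Side G c a b)
  have hS : Indep G S := fun z hz z' hz' hzz => by
    have hz := (hmem z).1 hz
    have hz' := (hmem z').1 hz'
    exact ((h.rot.rot.of_adj hz.1 hz'.1 hzz).adj_iff hy.2.2).1 (hadj z hz).symm (hadj z' hz').symm
  have hT : Indep G (insert b S) := hS.insert fun z hz => ((hmem z).1 hz).2.2.symm
  have hy'T : Link G (insert b S) y' := link_insert.2 ⟨hy'.2.1, fun z hz => by
    have hz := (hmem z).1 hz
    have htri := h.of_adj hy'.1 hy.1 hyy.symm
    exact (htri.far_of_not_adj hz.2.1 fun h' => (htri.adj_iff hz.2.1).1 h' (hadj z hz)).symm⟩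
  obtain ⟨w, hw, hyw⟩ := h.exists_adj _ y' hT hy'T
  obtain ⟨hbw, hw⟩ := link_insert.1 hw
  rcases h.rot.side_or_of_far hbw with hw' | hw'
  · exact hw.notMem ((hmem w).2 hw')
  · obtain ⟨z, hz⟩ := h.rot.rot.exists_side
    refine ((h.of_adj hy'.1 hy.1 hyy.symm).far_of_adj hw'.1 hyw.ne' ?_).2 hyw
    rintro rfl
    exact (hw z ((hmem z).2 hz)).symm.2 (hadj z hz)

theorem exists_adj_side [Finite V] (h : HasTriangle G n a b c) (hn : 4 ≤ n) {y y' : V}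
    (hy : Side G a b c y) (hy' : Side G a b c y') (hyy : G.Adj y y') :
    ∃ z z', Side G c a b z ∧ Side G c a b z' ∧ G.Adj z z' := by
  classical
  cases nonempty_fintype V
  by_contra! hno
  obtain ⟨z, hz, hyz⟩ := h.exists_far_side hy hy' hyy
  obtain ⟨z', hz', hyz'⟩ := h.exists_far_side hy' hy hyy.symm
  have hmem : ∀ u v, v ∈ Finset.univ.filter (fun v => Side G c a b v ∧ Far G u v) ↔
      Side G c a b v ∧ Far G u v := fun u v => by simp
  have h1 := h.card_far_side hy (hmem y)
    (fun u hu v hv => hno u v ((hmem y u).1 hu).1 ((hmem y v).1 hv).1) ((hmem y z).2 ⟨hz, hyz⟩)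
  have h2 := h.card_far_side hy' (hmem y')
    (fun u hu v hv => hno u v ((hmem y' u).1 hu).1 ((hmem y' v).1 hv).1)
    ((hmem y' z').2 ⟨hz', hyz'⟩)
  set S := Finset.univ.filter (fun v => Side G c a b v ∧ Far G y v)
  set S' := Finset.univ.filter (fun v => Side G c a b v ∧ Far G y' v)
  have hdisj : Disjoint S S' := by
    refine Finset.disjoint_left.2 fun v hv hv' => ?_
    have hv := (hmem y v).1 hv
    exact hv.2.2 (((h.of_adj hy.1 hy'.1 hyy).adj_iff hv.1.2.1).2 ((hmem y' v).1 hv').2.2)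
  have hside : ∀ v ∈ S ∪ S', Side G c a b v := fun v hv => by
    rcases Finset.mem_union.1 hv with hv | hv
    · exact ((hmem y v).1 hv).1
    · exact ((hmem y' v).1 hv).1
  have hl : Link G (S ∪ S') b := fun v hv => (hside v hv).2.2.symm
  have hcard := h.card_le _ (Indep.insert (S := S ∪ S')
    (fun u hu v hv => hno u v (hside u hu) (hside v hv)) hl)
  rw [Finset.card_insert_of_notMem hl.notMem, Finset.card_union_of_disjoint hdisj] at hcard
  omega

theorem exists_isolated (h : HasTriangle G n a b c) {y y' x : V} (hy : Side G a b c y)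
    (hy' : Side G a b c y') (hyy : G.Adj y y') (hx : Far G a x) :
    ∃ r, Side G a b c r ∧ G.Adj r x ∧ (∀ x, Side G a b c x → x ≠ r → Far G r x) ∧
      ∀ r', Side G a b c r' → (∀ x, Side G a b c x → x ≠ r' → Far G r' x) → G.Adj r' x →
        r' = r := by
  obtain ⟨u, hu, hux⟩ : ∃ u, Side G a b c u ∧ Far G u x := by
    have htri := h.of_adj hy.1 hy'.1 hyy
    by_cases hyx : G.Adj y x
    · exact ⟨y', hy', htri.swap.far_of_not_adj hx ((htri.adj_iff hx).1 hyx)⟩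
    · exact ⟨y, hy, htri.far_of_not_adj hx hyx⟩
  rcases h.side_or_of_far hx with hx | hx
  · have := h.swap.exists_isolated_of_far hu.swap hx.swap hux
    rwa [side_comm G a c b] at this
  · exact h.exists_isolated_of_far hu hx hux

theorem side_not_adj [Finite V] (h : HasTriangle G n a b c) {y y' : V} (hy : Side G a b c y)
    (hy' : Side G a b c y') : ¬ G.Adj y y' := by
  classical
  cases nonempty_fintype V
  intro hyy
  have hiso := fun x (hx : Far G a x) => h.exists_isolated hy hy' hyy hx
  have hyr : ∀ r, (∀ x, Side G a b c x → x ≠ r → Far G r x) → r ≠ y := by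
    rintro r hr rfl
    exact (hr y' hy' hyy.ne').2 hyy
  have hn : 4 ≤ n := by
    obtain ⟨x, hxc, -⟩ := h.exists_far_side hy hy' hyy
    obtain ⟨r, hr, hrx, hri, -⟩ := hiso x hxc.2.1
    obtain ⟨x', hax', hrx'⟩ := h.commonFar a r hr.1
    obtain ⟨s, hs, hsx, hsi, -⟩ := hiso x' hax'
    have hrs : r ≠ s := by
      rintro rfl
      exact hrx'.2 hsx
    have h1 : Link G {b} y := by simpa [Link] using hy.2.1
    have h2 : Link G (insert y {b}) r := link_insert.2 ⟨(hri y hy (hyr r hri).symm).symm, by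
      simpa [Link] using hr.2.1⟩
    have h3 : Link G (insert r (insert y {b})) s := link_insert.2 ⟨hri s hs hrs.symm,
      link_insert.2 ⟨(hsi y hy (hyr s hsi).symm).symm, by simpa [Link] using hs.2.1⟩⟩
    have hcard := h.card_le _ (((Indep.insert (S := {b}) (by simp [Indep]) h1).insert h2).insert h3)
    rwa [Finset.card_insert_of_notMem h3.notMem, Finset.card_insert_of_notMem h2.notMem,
      Finset.card_insert_of_notMem h1.notMem, Finset.card_singleton] at hcard
  obtain ⟨z, z', hz, hz', hzz⟩ := h.exists_adj_side hn hy hy' hyy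
  obtain ⟨w, w', hw, hw', hww⟩ := h.swap.exists_adj_side hn hy.swap hy'.swap hyy
  obtain ⟨r, hr, hrz, hri, hru⟩ := hiso z hz.2.1
  obtain ⟨s, hs, hsz, hsi, hsu⟩ := hiso z' hz'.2.1
  have htri := h.rot.rot.of_adj hz.1 hz'.1 hzz
  have hrz' : Far G r z' :=
    (htri.swap.far_of_not_adj hr.2.2 ((htri.adj_iff hr.2.2).1 hrz.symm)).symm
  have hrs : Far G r s := hri s hs (by
    rintro rfl
    exact hrz'.2 hsz)
  have hadj : ∀ x, Far G a x → Far G r x → G.Adj s x := fun x hx hrx => by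
    obtain ⟨t, ht, htx, hti, -⟩ := hiso x hx
    by_cases htz : G.Adj z t
    · exact absurd htx (hru t ht hti htz.symm ▸ hrx.2)
    · exact hsu t ht hti (by_contra fun h' => htz ((htri.adj_iff ht.2.2).2 fun h'' => h' h''.symm))
        ▸ htx
  obtain ⟨u, hu, hru⟩ : ∃ u, Side G b a c u ∧ Far G r u := by
    have htri' := h.rot.of_adj hw.1 hw'.1 hww
    by_cases hwr : G.Adj w r
    · exact ⟨w', hw', (htri'.swap.far_of_not_adj hr.2.1 ((htri'.adj_iff hr.2.1).1 hwr)).symm⟩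
    · exact ⟨w, hw, (htri'.far_of_not_adj hr.2.1 hwr).symm⟩
  have hind : ∀ p q, Far G a p → Far G a q → Far G r p → Far G r q → ¬ G.Adj p q :=
    fun p q hap haq hrp hrq hpq =>
      h.not_triangle r s p q hrs hrp hrq (hadj p hap hrp) hpq (hadj q haq hrq)
  have hP : ∀ v, v ∈ Finset.univ.filter (fun v => Side G c a b v ∧ Far G r v) ↔
      Side G c a b v ∧ Far G r v := fun v => by simp
  have hQ : ∀ v, v ∈ Finset.univ.filter (fun v => Side G b a c v ∧ Far G r v) ↔
      Side G b a c v ∧ Far G r v := fun v => by simp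
  set P := Finset.univ.filter (fun v => Side G c a b v ∧ Far G r v)
  set Q := Finset.univ.filter (fun v => Side G b a c v ∧ Far G r v)
  have h1 := h.card_far_side hr hP (fun p hp q hq => hind p q ((hP p).1 hp).1.2.1
    ((hP q).1 hq).1.2.1 ((hP p).1 hp).2 ((hP q).1 hq).2) ((hP z').2 ⟨hz', hrz'⟩)
  have h2 := h.swap.card_far_side hr.swap hQ (fun p hp q hq => hind p q ((hQ p).1 hp).1.2.1
    ((hQ q).1 hq).1.2.1 ((hQ p).1 hp).2 ((hQ q).1 hq).2) ((hQ u).2 ⟨hu, hru⟩)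
  have hdisj : Disjoint P Q :=
    Finset.disjoint_left.2 fun v hv hv' => ((hP v).1 hv).1.2.2.2 ((hQ v).1 hv').1.1
  have hfar : ∀ v ∈ P ∪ Q, Far G a v ∧ Far G r v := fun v hv => by
    rcases Finset.mem_union.1 hv with hv | hv
    · exact ⟨((hP v).1 hv).1.2.1, ((hP v).1 hv).2⟩
    · exact ⟨((hQ v).1 hv).1.2.1, ((hQ v).1 hv).2⟩
  have hl : Link G (P ∪ Q) r := fun v hv => (hfar v hv).2.symm
  have hcard := h.card_le _ (Indep.insert (S := P ∪ Q) (fun p hp q hq => hind p q (hfar p hp).1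
    (hfar q hq).1 (hfar p hp).2 (hfar q hq).2) hl)
  rw [Finset.card_insert_of_notMem hl.notMem, Finset.card_union_of_disjoint hdisj] at hcard
  omega

end HasTriangle

theorem nonempty_iso {G : SimpleGraph V} {m : ℕ} {E F : List (Fin m × Fin m)} (v : Fin m → V)
    (hsurj : ∀ x, ∃ i, x = v i) (hE : ∀ e ∈ E, G.Adj (v e.1) (v e.2))
    (hF : ∀ e ∈ F, Far G (v e.1) (v e.2))
    (hEF : ∀ i j, i = j ∨ (i, j) ∈ E ∨ (j, i) ∈ E ∨ (i, j) ∈ F ∨ (j, i) ∈ F) :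
    Nonempty (G ≃g SimpleGraph.fromRel (fun i j => (i, j) ∈ E)) := by
  have hfar : ∀ i j, ¬ i = j → ¬ ((i, j) ∈ E ∨ (j, i) ∈ E) → Far G (v i) (v j) := by
    intro i j hij hn
    rcases hEF i j with h | h | h | h | h
    · exact absurd h hij
    · exact absurd (Or.inl h) hn
    · exact absurd (Or.inr h) hn
    · exact hF _ h
    · exact (hF _ h).symm
  have hadj : ∀ i j, (i, j) ∈ E ∨ (j, i) ∈ E → G.Adj (v i) (v j) := by
    rintro i j (h | h)
    · exact hE _ h
    · exact (hE _ h).symm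
  have hinj : Function.Injective v := fun i j hij => by
    by_contra hne
    by_cases h : (i, j) ∈ E ∨ (j, i) ∈ E
    · exact (hadj i j h).ne hij
    · exact (hfar i j hne h).1 hij
  refine ⟨RelIso.symm ⟨Equiv.ofBijective v ⟨hinj, fun x => (hsurj x).imp fun i hi => hi.symm⟩,
    fun {i j} => ?_⟩⟩
  simp only [SimpleGraph.fromRel_adj]
  refine ⟨fun h => ⟨fun hij => h.ne (congrArg v hij), ?_⟩, fun h => hadj i j h.2⟩
  by_contra hn
  by_cases hij : i = j
  · exact h.ne (congrArg v hij)
  · exact (hfar i j hij hn).2 h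

namespace HasTriangle

variable {G : SimpleGraph V} {n : ℕ} {a b c : V}

theorem exists_ne_side [Finite V] (h : HasTriangle G n a b c) {y : V} (hy : Side G a b c y) :
    ∃ x, Side G a b c x ∧ x ≠ y := by
  classical
  have hT : Indep G {b, y} := by simp [Indep, hy.2.1.2, hy.2.1.symm.2]
  obtain ⟨w, hw, hwc⟩ := h.exists_link_far hT
    ((Finset.card_pair hy.2.1.1).trans_lt h.three_le) (i := y) (s := b) (c := c) (by simp)
    hy.2.2.symm (by simp) fun h' => h'.2 h.adj_bc
  exact ⟨w, h.side_of_far (hw b (by simp)) hwc.symm, (hw y (by simp)).1.symm⟩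

/-- Each vertex of the side of `a` has a neighbour in the side of `c` that is adjacent to no other
vertex of the side of `a`. -/
theorem exists_private [Finite V] (h : HasTriangle G n a b c) {y : V} (hy : Side G a b c y) :
    ∃ z, Side G c a b z ∧ G.Adj y z ∧ ∀ x, Side G a b c x → G.Adj x z → x = y := by
  classical
  cases nonempty_fintype V
  have hmem : ∀ x, x ∈ Finset.univ.filter (fun x => Side G a b c x ∧ x ≠ y) ↔
      Side G a b c x ∧ x ≠ y := fun x => by simp
  set S := Finset.univ.filter (fun x => Side G a b c x ∧ x ≠ y)
  have hS : Indep G S := fun x hx x' hx' => h.side_not_adj ((hmem x).1 hx).1 ((hmem x').1 hx').1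
  have hT : Indep G (insert b S) := hS.insert fun x hx => ((hmem x).1 hx).1.2.1.symm
  obtain ⟨w, hw, hyw⟩ := h.exists_adj _ y hT (link_insert.2 ⟨hy.2.1, fun x hx =>
    ⟨((hmem x).1 hx).2, h.side_not_adj ((hmem x).1 hx).1 hy⟩⟩)
  obtain ⟨hbw, hw⟩ := link_insert.1 hw
  rcases h.rot.side_or_of_far hbw with hw' | hw'
  · refine ⟨w, hw', hyw, fun x hx hxw => ?_⟩
    by_contra hxy
    exact (hw x ((hmem x).2 ⟨hx, hxy⟩)).2 hxw
  · exact absurd hyw (h.side_not_adj hy hw')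

theorem eq_of_adj [Finite V] (h : HasTriangle G n a b c) {y z z' : V} (hy : Side G a b c y)
    (hz : Side G b c a z) (hz' : Side G b c a z') (hyz : G.Adj y z) (hyz' : G.Adj y z') :
    z = z' := by
  obtain ⟨x, hx, hzx, hxu⟩ := h.rot.exists_private hz
  obtain ⟨u, hu, hxu', huu⟩ := h.swap.exists_private hx.swap
  obtain ⟨w, hw, hyw, hwu⟩ := h.swap.exists_private hy.swap
  obtain ⟨t, ht, hwt, htu⟩ := h.rot.exists_private hw.swap
  obtain rfl := hwu t ht.swap hwt.symm
  exact (htu z hz hyz.symm).trans (htu z' hz' hyz'.symm).symm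

theorem exists_matching [Finite V] (h : HasTriangle G n a b c) {y : V} (hy : Side G a b c y) :
    ∃ z, Side G b c a z ∧ G.Adj y z := by
  obtain ⟨z, hz, hyz, -⟩ := h.swap.exists_private hy.swap
  exact ⟨z, hz.swap, hyz⟩

theorem far_side [Finite V] (h : HasTriangle G n a b c) {y y' z : V} (hy : Side G a b c y)
    (hy' : Side G a b c y') (hz : Side G b c a z) (hyz : G.Adj y' z) (hne : y ≠ y') :
    Far G y z := by
  refine ⟨?_, fun hadj => hne ?_⟩
  · rintro rfl
    exact hz.2.2.2 hy.1
  · exact h.swap.rot.rot.eq_of_adj hz.swap hy.swap hy'.swap hadj.symm hyz.symm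

end HasTriangle

/-- The vertices `i`, `j`, `k`, `l` form a path that runs through the sides of `a`, `b`, `c` and
back to the side of `a`. -/
structure Around (G : SimpleGraph V) (a b c i j k l : V) : Prop where
  fst : Side G a b c i
  snd : Side G b c a j
  trd : Side G c a b k
  last : Side G a b c l
  adj_fst : G.Adj i j
  adj_snd : G.Adj j k
  adj_trd : G.Adj k l

namespace HasTriangle

variable {G : SimpleGraph V} {n : ℕ} {a b c i j k l i' j' k' l' : V}

theorem exists_around [Finite V] (h : HasTriangle G n a b c) (hi : Side G a b c i) :
    ∃ j k l, Around G a b c i j k l := by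
  obtain ⟨j, hj, hij⟩ := h.exists_matching hi
  obtain ⟨k, hk, hjk⟩ := h.rot.exists_matching hj
  obtain ⟨l, hl, hkl⟩ := h.rot.rot.exists_matching hk
  exact ⟨j, k, l, hi, hj, hk, hl, hij, hjk, hkl⟩

theorem far_of_side [Finite V] (h : HasTriangle G n a b c) (hi : Side G a b c i)
    (hi' : Side G a b c i') (hne : i ≠ i') : Far G i i' :=
  ⟨hne, h.side_not_adj hi hi'⟩

theorem eq_of_adj_right [Finite V] (h : HasTriangle G n a b c) (hi : Side G a b c i)
    (hi' : Side G a b c i') (hj : Side G b c a j) (hij : G.Adj i j) (hij' : G.Adj i' j) :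
    i = i' := by
  by_contra hne
  exact (h.far_side hi hi' hj hij' hne).2 hij

theorem far_side_of_adj [Finite V] (h : HasTriangle G n a b c) (hi : Side G a b c i)
    (hj : Side G b c a j) (hj' : Side G b c a j') (hij : G.Adj i j') (hne : j ≠ j') :
    Far G i j := by
  refine ⟨?_, fun hij' => hne (h.eq_of_adj hi hj hj' hij' hij)⟩
  rintro rfl
  exact hj.2.2.2 hi.1

theorem around_ne [Finite V] (h : HasTriangle G n a b c) (p : Around G a b c i j k l) : i ≠ l := by
  rintro rfl
  obtain ⟨x, hx, hxi⟩ := h.exists_ne_side p.fst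
  exact h.not_triangle x i j k (h.far_of_side hx p.fst hxi)
    (h.far_side hx p.fst p.snd p.adj_fst hxi)
    (h.swap.far_side hx.swap p.fst.swap p.trd.swap p.adj_trd.symm hxi) p.adj_fst p.adj_snd
    p.adj_trd.symm

theorem around_inj [Finite V] (h : HasTriangle G n a b c) (p : Around G a b c i j k l)
    (q : Around G a b c i' j' k' l') (hne : i ≠ i') : j ≠ j' ∧ k ≠ k' ∧ l ≠ l' := by
  have hj : j ≠ j' := by
    rintro rfl
    exact hne (h.eq_of_adj_right p.fst q.fst p.snd p.adj_fst q.adj_fst)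
  have hk : k ≠ k' := by
    rintro rfl
    exact hj (h.rot.eq_of_adj_right p.snd q.snd p.trd p.adj_snd q.adj_snd)
  refine ⟨hj, hk, ?_⟩
  rintro rfl
  exact hk (h.rot.rot.eq_of_adj_right p.trd q.trd p.last p.adj_trd q.adj_trd)

theorem around_unique [Finite V] (h : HasTriangle G n a b c) (p : Around G a b c i j k l)
    (q : Around G a b c i j' k' l') : j = j' ∧ k = k' ∧ l = l' := by
  obtain rfl := h.eq_of_adj p.fst p.snd q.snd p.adj_fst q.adj_fst
  obtain rfl := h.rot.eq_of_adj p.snd p.trd q.trd p.adj_snd q.adj_snd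
  exact ⟨rfl, rfl, h.rot.rot.eq_of_adj p.trd p.last q.last p.adj_trd q.adj_trd⟩

theorem eq_last_or_eq_last [Finite V] (h : HasTriangle G n a b c) (p : Around G a b c i j k l)
    (q : Around G a b c i' j' k' l') (hne : i ≠ i') : i' = l ∨ i = l' := by
  classical
  cases nonempty_fintype V
  by_contra! hno
  obtain ⟨hj, hk, hl⟩ := h.around_inj p q hne
  have hmem : ∀ v, v ∈ Finset.univ.filter (fun v => Side G b c a v ∧ v ≠ j ∧ v ≠ j') ↔
      Side G b c a v ∧ v ≠ j ∧ v ≠ j' := fun v => by simp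
  set S := Finset.univ.filter (fun v => Side G b c a v ∧ v ≠ j ∧ v ≠ j')
  have hS : Indep G S := fun x hx y hy => h.rot.side_not_adj ((hmem x).1 hx).1 ((hmem y).1 hy).1
  have hk' : Link G S k' := fun x hx =>
    h.rot.far_side ((hmem x).1 hx).1 q.snd q.trd q.adj_snd ((hmem x).1 hx).2.2
  have hk : Link G (insert k' S) k := link_insert.2 ⟨h.rot.rot.far_of_side q.trd p.trd hk.symm,
    fun x hx => h.rot.far_side ((hmem x).1 hx).1 p.snd p.trd p.adj_snd ((hmem x).1 hx).2.1⟩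
  have hi' : Link G (insert k (insert k' S)) i' := link_insert.2
    ⟨h.rot.rot.far_side_of_adj p.trd q.fst p.last p.adj_trd hno.1, link_insert.2
    ⟨h.rot.rot.far_side_of_adj q.trd q.fst q.last q.adj_trd (h.around_ne q),
    fun x hx => (h.far_side_of_adj q.fst ((hmem x).1 hx).1 q.snd q.adj_fst ((hmem x).1 hx).2.2).symm⟩⟩
  have hi : Link G (insert i' (insert k (insert k' S))) i := link_insert.2
    ⟨h.far_of_side q.fst p.fst hne.symm, link_insert.2
    ⟨h.rot.rot.far_side_of_adj p.trd p.fst p.last p.adj_trd (h.around_ne p), link_insert.2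
    ⟨h.rot.rot.far_side_of_adj q.trd p.fst q.last q.adj_trd hno.2,
    fun x hx => (h.far_side_of_adj p.fst ((hmem x).1 hx).1 p.snd p.adj_fst ((hmem x).1 hx).2.1).symm⟩⟩⟩
  have hcard := h.card_le _ ((((hS.insert hk').insert hk).insert hi').insert hi)
  rw [Finset.card_insert_of_notMem hi.notMem, Finset.card_insert_of_notMem hi'.notMem,
    Finset.card_insert_of_notMem hk.notMem, Finset.card_insert_of_notMem hk'.notMem] at hcard
  have hlj' : Link G S j' := fun x hx =>
    h.rot.far_of_side ((hmem x).1 hx).1 q.snd ((hmem x).1 hx).2.2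
  have hlj : Link G (insert j' S) j := link_insert.2 ⟨h.rot.far_of_side q.snd p.snd hj.symm,
    fun x hx => h.rot.far_of_side ((hmem x).1 hx).1 p.snd ((hmem x).1 hx).2.1⟩
  have hlc : Link G (insert j (insert j' S)) c := link_insert.2 ⟨p.snd.2.1.symm, link_insert.2
    ⟨q.snd.2.1.symm, fun x hx => ((hmem x).1 hx).1.2.1.symm⟩⟩
  obtain ⟨v, hv⟩ := h.exists_link _ (((hS.insert hlj').insert hlj).insert hlc) (by
    rw [Finset.card_insert_of_notMem hlc.notMem, Finset.card_insert_of_notMem hlj.notMem,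
      Finset.card_insert_of_notMem hlj'.notMem]
    omega)
  obtain ⟨hcv, hv⟩ := link_insert.1 hv
  obtain ⟨hjv, hv⟩ := link_insert.1 hv
  obtain ⟨hjv', hv⟩ := link_insert.1 hv
  have key : ∀ w, Side G b c a w → Far G w v ∨ w = v := fun w hw => by
    by_cases h1 : w = j
    · exact Or.inl (h1 ▸ hjv)
    by_cases h2 : w = j'
    · exact Or.inl (h2 ▸ hjv')
    · exact Or.inl (hv w ((hmem w).2 ⟨hw, h1, h2⟩))
  rcases h.rot.rot.side_or_of_far hcv with hv' | hv'
  · obtain ⟨w, hw, hvw⟩ := h.exists_matching hv'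
    rcases key w hw with h' | h'
    · exact h'.2 hvw.symm
    · exact hvw.ne' h'
  · refine hv.notMem ((hmem v).2 ⟨hv', hjv.1.symm, hjv'.1.symm⟩)

/-- A property of the three vertices of the triangle and of all vertices on paths `Around` the
triangle holds everywhere. -/
theorem forall_of_around [Finite V] (h : HasTriangle G n a b c) {P : V → Prop} (ha : P a) (hb : P b)
    (hc : P c) (hP : ∀ i j k l, Around G a b c i j k l → P i ∧ P j ∧ P k) (x : V) : P x := by
  by_cases hxa : x = a
  · exact hxa ▸ ha
  by_cases hxb : x = b
  · exact hxb ▸ hb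
  by_cases hxc : x = c
  · exact hxc ▸ hc
  rcases h.side_or hxa hxb hxc with hx | hx | hx
  · obtain ⟨j, k, l, p⟩ := h.exists_around hx
    exact (hP _ _ _ _ p).1
  · obtain ⟨i, hi, hxi⟩ := h.rot.swap.exists_matching hx.swap
    obtain ⟨j, k, l, p⟩ := h.exists_around hi.swap
    exact h.eq_of_adj hi.swap hx p.snd hxi.symm p.adj_fst ▸ (hP _ _ _ _ p).2.1
  · obtain ⟨j, hj, hxj⟩ := h.rot.rot.swap.exists_matching hx.swap
    obtain ⟨i, hi, hji⟩ := h.rot.swap.exists_matching hj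
    obtain ⟨j', k, l, p⟩ := h.exists_around hi.swap
    obtain rfl := h.eq_of_adj hi.swap hj.swap p.snd hji.symm p.adj_fst
    exact h.rot.eq_of_adj p.snd hx p.trd hxj.symm p.adj_snd ▸ (hP _ _ _ _ p).2.2

end HasTriangle

namespace HasTriangle

variable {G : SimpleGraph V} {n : ℕ} {a b c i j k l i' j' k' l' : V}

theorem far_of_around [Finite V] (h : HasTriangle G n a b c) (p : Around G a b c i j k l)
    (q : Around G a b c i' j' k' l') (hne : i ≠ i') :
    Far G i i' ∧ Far G j j' ∧ Far G k k' ∧ Far G i j' ∧ Far G j k' := by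
  obtain ⟨hj, hk, -⟩ := h.around_inj p q hne
  exact ⟨h.far_of_side p.fst q.fst hne, h.rot.far_of_side p.snd q.snd hj,
    h.rot.rot.far_of_side p.trd q.trd hk, h.far_side_of_adj p.fst q.snd p.snd p.adj_fst hj.symm,
    h.rot.far_side_of_adj p.snd q.trd p.trd p.adj_snd hk.symm⟩

theorem nonempty_iso_Q9 [Finite V] (h : HasTriangle G n a b c) {i₀ j₀ k₀ i₁ j₁ k₁ : V}
    (p : Around G a b c i₀ j₀ k₀ i₁) (q : Around G a b c i₁ j₁ k₁ i₀) :
    Nonempty (G ≃g Q9) := by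
  have hpq := h.around_ne p
  obtain ⟨f1, f2, f3, f4, f5⟩ := h.far_of_around p q hpq
  obtain ⟨-, -, -, f6, f7⟩ := h.far_of_around q p hpq.symm
  have f8 := (h.rot.rot.far_side_of_adj p.trd p.fst p.last p.adj_trd hpq).symm
  have f9 := (h.rot.rot.far_side_of_adj q.trd q.fst q.last q.adj_trd hpq.symm).symm
  have hsurj : ∀ x, ∃ t : Fin 9, x = ![a, b, c, i₀, i₁, j₁, j₀, k₁, k₀] t := by
    have hA : ∀ i j k l, Around G a b c i j k l → i = i₀ ∨ i = i₁ := fun i j k l r => by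
      by_contra! hne
      rcases h.eq_last_or_eq_last p r hne.1.symm with h' | h'
      · exact hne.2 h'
      · rcases h.eq_last_or_eq_last q r hne.2.symm with h'' | h''
        · exact hne.1 h''
        · exact hpq (h'.trans h''.symm)
    refine h.forall_of_around ⟨0, rfl⟩ ⟨1, rfl⟩ ⟨2, rfl⟩ fun i j k l r => ?_
    rcases hA i j k l r with rfl | rfl
    · obtain ⟨rfl, rfl, -⟩ := h.around_unique p r
      exact ⟨⟨3, rfl⟩, ⟨6, rfl⟩, ⟨8, rfl⟩⟩
    · obtain ⟨rfl, rfl, -⟩ := h.around_unique q r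
      exact ⟨⟨4, rfl⟩, ⟨5, rfl⟩, ⟨7, rfl⟩⟩
  have hab := h.adj_ab
  have hbc := h.adj_bc
  have hac := h.adj_ac
  obtain ⟨⟨s1, s2, s3⟩, ⟨s4, s5, s6⟩, ⟨s7, s8, s9⟩, -, s10, s11, s12⟩ := p
  obtain ⟨⟨t1, t2, t3⟩, ⟨t4, t5, t6⟩, ⟨t7, t8, t9⟩, -, t10, t11, t12⟩ := q
  refine nonempty_iso (F := [(0, 5), (0, 6), (0, 7), (0, 8), (1, 3), (1, 4), (1, 7), (1, 8),
    (2, 3), (2, 4), (2, 5), (2, 6), (3, 4), (3, 5), (3, 8), (4, 6), (4, 7), (5, 6), (5, 8), (6, 7),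
    (7, 8)]) _ hsurj ?_ ?_ (by decide)
  · simp only [edgesQ9, List.forall_mem_cons]
    repeat' first | assumption | exact SimpleGraph.Adj.symm (by assumption) | constructor | simp
  · simp only [List.forall_mem_cons]
    repeat' first | assumption | exact Far.symm (by assumption) | constructor | simp

theorem nonempty_iso_Q12 [Finite V] (h : HasTriangle G n a b c) {i₀ j₀ k₀ i₁ j₁ k₁ i₂ j₂ k₂ : V}
    (p : Around G a b c i₀ j₀ k₀ i₁) (q : Around G a b c i₁ j₁ k₁ i₂)
    (r : Around G a b c i₂ j₂ k₂ i₀) : Nonempty (G ≃g Q12) := by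
  have hpq := h.around_ne p
  have hqr := h.around_ne q
  have hrp := h.around_ne r
  obtain ⟨f1, f2, f3, f4, f5⟩ := h.far_of_around p q hpq
  obtain ⟨-, -, -, f6, f7⟩ := h.far_of_around q p hpq.symm
  obtain ⟨f8, f9, f10, f11, f12⟩ := h.far_of_around q r hqr
  obtain ⟨-, -, -, f13, f14⟩ := h.far_of_around r q hqr.symm
  obtain ⟨f15, f16, f17, f18, f19⟩ := h.far_of_around r p hrp
  obtain ⟨-, -, -, f20, f21⟩ := h.far_of_around p r hrp.symm
  have g1 := (h.rot.rot.far_side_of_adj p.trd p.fst p.last p.adj_trd hpq).symm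
  have g2 := (h.rot.rot.far_side_of_adj q.trd q.fst q.last q.adj_trd hqr).symm
  have g3 := (h.rot.rot.far_side_of_adj r.trd r.fst r.last r.adj_trd hrp).symm
  have g4 := (h.rot.rot.far_side_of_adj p.trd r.fst p.last p.adj_trd hqr.symm).symm
  have g5 := (h.rot.rot.far_side_of_adj q.trd p.fst q.last q.adj_trd hrp.symm).symm
  have g6 := (h.rot.rot.far_side_of_adj r.trd q.fst r.last r.adj_trd hpq.symm).symm
  have hsurj : ∀ x, ∃ t : Fin 12, x = ![a, b, c, i₀, i₁, i₂, j₂, j₀, j₁, k₂, k₀, k₁] t := by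
    have hA : ∀ i j k l, Around G a b c i j k l → i = i₀ ∨ i = i₁ ∨ i = i₂ := fun i j k l u => by
      by_contra! hne
      have h0 := (h.eq_last_or_eq_last p u hne.1.symm).resolve_left hne.2.1
      have h1 := (h.eq_last_or_eq_last q u hne.2.1.symm).resolve_left hne.2.2
      exact hpq (h0.trans h1.symm)
    refine h.forall_of_around ⟨0, rfl⟩ ⟨1, rfl⟩ ⟨2, rfl⟩ fun i j k l u => ?_
    rcases hA i j k l u with rfl | rfl | rfl
    · obtain ⟨rfl, rfl, -⟩ := h.around_unique p u
      exact ⟨⟨3, rfl⟩, ⟨7, rfl⟩, ⟨10, rfl⟩⟩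
    · obtain ⟨rfl, rfl, -⟩ := h.around_unique q u
      exact ⟨⟨4, rfl⟩, ⟨8, rfl⟩, ⟨11, rfl⟩⟩
    · obtain ⟨rfl, rfl, -⟩ := h.around_unique r u
      exact ⟨⟨5, rfl⟩, ⟨6, rfl⟩, ⟨9, rfl⟩⟩
  have hab := h.adj_ab
  have hbc := h.adj_bc
  have hac := h.adj_ac
  obtain ⟨⟨s1, s2, s3⟩, ⟨s4, s5, s6⟩, ⟨s7, s8, s9⟩, -, s10, s11, s12⟩ := p
  obtain ⟨⟨t1, t2, t3⟩, ⟨t4, t5, t6⟩, ⟨t7, t8, t9⟩, -, t10, t11, t12⟩ := q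
  obtain ⟨⟨u1, u2, u3⟩, ⟨u4, u5, u6⟩, ⟨u7, u8, u9⟩, -, u10, u11, u12⟩ := r
  refine nonempty_iso (F := [(0, 6), (0, 7), (0, 8), (0, 9), (0, 10), (0, 11), (1, 3), (1, 4),
    (1, 5), (1, 9), (1, 10), (1, 11), (2, 3), (2, 4), (2, 5), (2, 6), (2, 7), (2, 8), (3, 4),
    (3, 5), (3, 6), (3, 8), (3, 10), (3, 11), (4, 5), (4, 6), (4, 7), (4, 9), (4, 11), (5, 7),
    (5, 8), (5, 9), (5, 10), (6, 7), (6, 8), (6, 10), (6, 11), (7, 8), (7, 9), (7, 11), (8, 9),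
    (8, 10), (9, 10), (9, 11), (10, 11)]) _ hsurj ?_ ?_ (by decide)
  · simp only [edgesQ12, List.forall_mem_cons]
    repeat' first | assumption | exact SimpleGraph.Adj.symm (by assumption) | constructor | simp
  · simp only [List.forall_mem_cons]
    repeat' first | assumption | exact Far.symm (by assumption) | constructor | simp

/-- A graph with the given properties is `Q9` or `Q12`. -/
theorem nonempty_iso_Q9_or_Q12 [Finite V] (h : HasTriangle G n a b c) :
    Nonempty (G ≃g Q9) ∨ Nonempty (G ≃g Q12) := by
  obtain ⟨i₀, hi₀⟩ := h.exists_side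
  obtain ⟨j₀, k₀, i₁, p⟩ := h.exists_around hi₀
  obtain ⟨j₁, k₁, i₂, q⟩ := h.exists_around p.last
  by_cases h20 : i₂ = i₀
  · exact Or.inl (h.nonempty_iso_Q9 p (h20 ▸ q))
  obtain ⟨j₂, k₂, i₃, r⟩ := h.exists_around q.last
  rcases h.eq_last_or_eq_last p r (Ne.symm h20) with h' | rfl
  · exact absurd h'.symm (h.around_ne q)
  · exact Or.inr (h.nonempty_iso_Q12 p q r)

end HasTriangle

/-- Two adjacent vertices without common non-neighbour in a locally triangle-free graph in `W₂` with
independence number three. -/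
structure IsDominating (G : SimpleGraph V) (a b : V) : Prop extends IsLTFW2 G 3 where
  adj : G.Adj a b
  not_far : ∀ z, Far G a z → ¬ Far G b z

/-- Consecutive vertices `x`, `x'` of `G \ N[a]` and consecutive vertices `y`, `y'` of `G \ N[b]`
that form two adjacent triangles of the complement. -/
structure Strip (G : SimpleGraph V) (a b x y x' y' : V) : Prop where
  left_fst : Far G a x
  left_snd : Far G a x'
  right_fst : Far G b y
  right_snd : Far G b y'
  fst : Far G x y
  cross : Far G x y'
  snd : Far G x' y'
  left : Far G x x'
  right : Far G y y'
  adj : G.Adj x' y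

theorem Strip.swap {G : SimpleGraph V} {a b x y x' y' : V} (s : Strip G a b x y x' y') :
    Strip G b a y' x' y x :=
  ⟨s.right_snd, s.right_fst, s.left_snd, s.left_fst, s.snd.symm, s.cross.symm, s.fst.symm,
    s.right.symm, s.left.symm, s.adj.symm⟩

namespace IsDominating

variable {G : SimpleGraph V} {a b x y x' y' x'' y'' : V}

theorem swap (h : IsDominating G a b) : IsDominating G b a :=
  { h with adj := h.adj.symm, not_far := fun z hb ha => h.not_far z ha hb }

theorem adj_of_far_right (h : IsDominating G a b) {z : V} (hz : Far G b z) : G.Adj a z := by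
  refine adj_of_not_far (fun ha => h.not_far z ha hz) ?_
  rintro rfl
  exact hz.2 h.adj.symm

theorem eq_or_eq_of_strip [Fintype V] (h : IsDominating G a b) (s : Strip G a b x y x' y') {z : V}
    (hx : Far G x z) (hb : Far G b z) : z = y ∨ z = y' := by
  classical
  obtain ⟨S, hS, -, hcard⟩ := h.exists_common_far h.adj h.not_far s.left_fst s.right_fst s.fst
  by_contra! hne
  have hsub : {z, y, y'} ⊆ S := by
    simp [Finset.insert_subset_iff, hS, hx, hb, s.fst, s.cross, s.right_fst, s.right_snd]
  have := Finset.card_le_card hsub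
  rw [Finset.card_eq_three.2 ⟨z, y, y', hne.1, hne.2, s.right.1, rfl⟩] at this
  omega

theorem exists_far_right [Fintype V] (h : IsDominating G a b) (hax : Far G a x) (hby : Far G b y)
    (hxy : Far G x y) : ∃ y', Far G b y' ∧ Far G x y' ∧ Far G y y' := by
  classical
  obtain ⟨S, hS, hind, hcard⟩ := h.exists_common_far h.adj h.not_far hax hby hxy
  obtain ⟨y', hy', hne⟩ := Finset.exists_mem_ne (s := S) (by omega) y
  exact ⟨y', ((hS y').1 hy').2, ((hS y').1 hy').1, hne.symm,
    hind y ((hS y).2 ⟨hxy, hby⟩) y' hy'⟩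

theorem exists_strip [Fintype V] (h : IsDominating G a b) (hax : Far G a x) (hby : Far G b y)
    (hby' : Far G b y') (hxy : Far G x y) (hxy' : Far G x y') (hyy : Far G y y') :
    ∃ x', Strip G a b x y x' y' := by
  obtain ⟨w, haw, hxw, hwy, hw⟩ := h.exists_flip le_rfl h.adj h.not_far hax hby hxy
  exact ⟨w, hax, haw, hby, hby', hxy, hxy', hw y' hyy.1.symm hxy' hby', hxw, hyy, hwy⟩

theorem exists_next [Fintype V] (h : IsDominating G a b) (s : Strip G a b x y x' y') :
    ∃ x'' y'', Strip G a b x' y' x'' y'' := by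
  obtain ⟨y'', hb, hx, hy⟩ := h.exists_far_right s.left_snd s.right_snd s.snd
  obtain ⟨x'', s'⟩ := h.exists_strip s.left_snd s.right_snd hb s.snd hx hy
  exact ⟨x'', y'', s'⟩

theorem adj_left (h : IsDominating G a b) (s : Strip G a b x y x' y')
    (t : Strip G a b x' y' x'' y'') : G.Adj x x'' := by
  refine h.adj_of_far s.left_snd.symm s.left.symm t.left s.left_fst t.left_snd ?_
  rintro rfl
  exact s.cross.2 t.adj

theorem adj_right (h : IsDominating G a b) (s : Strip G a b x y x' y')
    (t : Strip G a b x' y' x'' y'') : G.Adj y y'' :=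
  (h.swap.adj_left t.swap s.swap).symm

theorem adj_diag [Fintype V] (h : IsDominating G a b) (s : Strip G a b x y x' y')
    (t : Strip G a b x' y' x'' y'') : G.Adj x y'' := by
  refine adj_of_not_far (fun hx => ?_) ?_
  · rcases h.eq_or_eq_of_strip s hx t.right_snd with rfl | rfl
    · exact (h.adj_right s t).ne rfl
    · exact t.right.1 rfl
  · rintro rfl
    exact h.not_far _ s.left_fst t.right_snd

theorem mem_of_strip (h : IsDominating G a b) (s : Strip G a b x y x' y')
    (t : Strip G a b x' y' x'' y'') {z : V} (hz : Far G x' z) :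
    z = a ∨ z = x ∨ z = y' ∨ z = y'' ∨ z = x'' := by
  refine h.mem_pentagon s.left_snd.symm s.left.symm s.snd t.cross t.left s.left_fst s.cross t.right
    t.left_snd.symm ?_ ?_ ?_ hz
  · exact (h.adj_of_far_right s.right_snd).ne
  · rintro rfl
    exact h.not_far _ s.left_fst t.right_snd
  · exact (h.adj_left s t).ne'

end IsDominating

namespace IsDominating

variable {G : SimpleGraph V} {a b x₀ y₀ x₁ y₁ x₂ y₂ x₃ y₃ x₄ y₄ : V}

theorem mem_left (h : IsDominating G a b) (s : Strip G a b x₀ y₀ x₁ y₁)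
    (t : Strip G a b x₁ y₁ x₂ y₂) (u : Strip G a b x₂ y₂ x₃ y₃) (v : Strip G a b x₃ y₃ x₄ y₄)
    {z : V} (hz : Far G a z) : z = x₀ ∨ z = x₁ ∨ z = x₂ ∨ z = x₃ ∨ z = x₄ := by
  by_contra! hne
  refine h.not_triangle a z x₁ x₃ hz s.left_snd u.left_snd (adj_of_not_far (fun hf => ?_) hne.2.1)
    (h.adj_left t u) (adj_of_not_far (fun hf => ?_) hne.2.2.2.1)
  · rcases h.eq_or_eq_of_far s.left_snd s.left_fst t.left_snd hz s.left.symm t.left hf.symm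
      (h.adj_left s t).ne with h' | h'
    · exact hne.1 h'
    · exact hne.2.2.1 h'
  · rcases h.eq_or_eq_of_far u.left_snd u.left_fst v.left_snd hz u.left.symm v.left hf.symm
      (h.adj_left u v).ne with h' | h'
    · exact hne.2.2.1 h'
    · exact hne.2.2.2.2 h'

theorem adj_long [Fintype V] (h : IsDominating G a b) (s : Strip G a b x₀ y₀ x₁ y₁)
    (t : Strip G a b x₁ y₁ x₂ y₂) (u : Strip G a b x₂ y₂ x₃ y₃) (hy : G.Adj y₃ y₀) :
    G.Adj x₀ y₃ := by
  refine adj_of_not_far (fun hx => ?_) ?_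
  · rcases h.eq_or_eq_of_strip s hx u.right_snd with rfl | rfl
    · exact hy.ne rfl
    · exact (h.adj_right t u).ne rfl
  · rintro rfl
    exact h.not_far _ s.left_fst u.right_snd

theorem nonempty_iso_P10 [Fintype V] (h : IsDominating G a b) (hjoin : ¬ IsJoin G)
    (s : Strip G a b x₀ y₀ x₁ y₁) (t : Strip G a b x₁ y₁ x₂ y₂) (u : Strip G a b x₂ y₂ x₃ y₃)
    (v : Strip G a b x₃ y₃ x₀ y₀) : Nonempty (G ≃g P10) := by
  have hsurj : ∀ z, ∃ i : Fin 10, z = ![a, y₀, y₂, y₁, y₃, b, x₁, x₂, x₃, x₀] i := by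
    have hU := eq_univ_of_not_isJoin hjoin (U := {z | z = a ∨ z = y₀ ∨ z = y₂ ∨ z = y₁ ∨ z = y₃ ∨
      z = b ∨ z = x₁ ∨ z = x₂ ∨ z = x₃ ∨ z = x₀}) (u := a) (Or.inl rfl) ?_
    · intro z
      rcases (hU ▸ mem_univ z : z ∈ {z | z = a ∨ z = y₀ ∨ z = y₂ ∨ z = y₁ ∨ z = y₃ ∨
        z = b ∨ z = x₁ ∨ z = x₂ ∨ z = x₃ ∨ z = x₀}) with
        hz | hz | hz | hz | hz | hz | hz | hz | hz | hz
      exacts [⟨0, hz⟩, ⟨1, hz⟩, ⟨2, hz⟩, ⟨3, hz⟩, ⟨4, hz⟩, ⟨5, hz⟩, ⟨6, hz⟩, ⟨7, hz⟩, ⟨8, hz⟩,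
        ⟨9, hz⟩]
    · rintro w (rfl | rfl | rfl | rfl | rfl | rfl | rfl | rfl | rfl | rfl) z hz <;>
        simp only [mem_ofPred_eq]
      · have := h.mem_left s t u v hz; tauto
      · have := h.swap.mem_of_strip s.swap v.swap hz; tauto
      · have := h.swap.mem_of_strip u.swap t.swap hz; tauto
      · have := h.swap.mem_of_strip t.swap s.swap hz; tauto
      · have := h.swap.mem_of_strip v.swap u.swap hz; tauto
      · have := h.swap.mem_left v.swap u.swap t.swap s.swap hz; tauto
      · have := h.mem_of_strip s t hz; tauto
      · have := h.mem_of_strip t u hz; tauto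
      · have := h.mem_of_strip u v hz; tauto
      · have := h.mem_of_strip v s hz; tauto
  have a1 := h.adj
  have a2 := h.adj_of_far_right s.right_fst
  have a3 := h.adj_of_far_right s.right_snd
  have a4 := h.adj_of_far_right u.right_fst
  have a5 := h.adj_of_far_right u.right_snd
  have a6 := h.swap.adj_of_far_right s.left_fst
  have a7 := h.swap.adj_of_far_right s.left_snd
  have a8 := h.swap.adj_of_far_right u.left_fst
  have a9 := h.swap.adj_of_far_right u.left_snd
  have b1 := h.adj_left s t
  have b2 := h.adj_left t u
  have b3 := h.adj_right s t
  have b4 := h.adj_right t u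
  have c1 := h.adj_diag s t
  have c2 := h.adj_diag t u
  have c3 := h.adj_diag u v
  have c4 := h.adj_diag v s
  obtain ⟨s1, s2, s3, s4, s5, s6, -, s7, s8, s9⟩ := s
  obtain ⟨t1, t2, t3, t4, t5, t6, -, t7, t8, t9⟩ := t
  obtain ⟨u1, u2, u3, u4, u5, u6, -, u7, u8, u9⟩ := u
  obtain ⟨v1, v2, v3, v4, v5, v6, -, v7, v8, v9⟩ := v
  refine nonempty_iso (F := [(0, 6), (0, 7), (0, 8), (0, 9), (1, 3), (1, 4), (1, 5), (1, 8), (1, 9),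
    (2, 3), (2, 4), (2, 5), (2, 6), (2, 7), (3, 5), (3, 6), (3, 9), (4, 5), (4, 7), (4, 8), (6, 7),
    (6, 9), (7, 8), (8, 9)]) _ hsurj ?_ ?_ (by decide)
  · simp only [edgesP10, List.forall_mem_cons]
    repeat' first | assumption | exact SimpleGraph.Adj.symm (by assumption) | constructor | simp
  · simp only [List.forall_mem_cons]
    repeat' first | assumption | exact Far.symm (by assumption) | constructor | simp

theorem nonempty_iso_P12 [Fintype V] (h : IsDominating G a b) (hjoin : ¬ IsJoin G)
    (s : Strip G a b x₀ y₀ x₁ y₁) (t : Strip G a b x₁ y₁ x₂ y₂) (u : Strip G a b x₂ y₂ x₃ y₃)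
    (v : Strip G a b x₃ y₃ x₄ y₄) (w : Strip G a b x₄ y₄ x₀ y₀) : Nonempty (G ≃g P12) := by
  have hsurj : ∀ z, ∃ i : Fin 12, z = ![a, y₀, y₂, y₃, y₄, y₁, x₃, x₁, b, x₂, x₀, x₄] i := by
    have hU := eq_univ_of_not_isJoin hjoin (U := {z | z = a ∨ z = y₀ ∨ z = y₂ ∨ z = y₃ ∨ z = y₄ ∨
      z = y₁ ∨ z = x₃ ∨ z = x₁ ∨ z = b ∨ z = x₂ ∨ z = x₀ ∨ z = x₄}) (u := a) (Or.inl rfl) ?_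
    · intro z
      rcases (hU ▸ mem_univ z : z ∈ {z | z = a ∨ z = y₀ ∨ z = y₂ ∨ z = y₃ ∨ z = y₄ ∨
        z = y₁ ∨ z = x₃ ∨ z = x₁ ∨ z = b ∨ z = x₂ ∨ z = x₀ ∨ z = x₄}) with
        hz | hz | hz | hz | hz | hz | hz | hz | hz | hz | hz | hz
      exacts [⟨0, hz⟩, ⟨1, hz⟩, ⟨2, hz⟩, ⟨3, hz⟩, ⟨4, hz⟩, ⟨5, hz⟩, ⟨6, hz⟩, ⟨7, hz⟩, ⟨8, hz⟩,
        ⟨9, hz⟩, ⟨10, hz⟩, ⟨11, hz⟩]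
    · rintro p (rfl | rfl | rfl | rfl | rfl | rfl | rfl | rfl | rfl | rfl | rfl | rfl) z hz <;>
        simp only [mem_ofPred_eq]
      · have := h.mem_left s t u v hz; tauto
      · have := h.swap.mem_of_strip s.swap w.swap hz; tauto
      · have := h.swap.mem_of_strip u.swap t.swap hz; tauto
      · have := h.swap.mem_of_strip v.swap u.swap hz; tauto
      · have := h.swap.mem_of_strip w.swap v.swap hz; tauto
      · have := h.swap.mem_of_strip t.swap s.swap hz; tauto
      · have := h.mem_of_strip u v hz; tauto
      · have := h.mem_of_strip s t hz; tauto
      · have := h.swap.mem_left v.swap u.swap t.swap s.swap hz; tauto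
      · have := h.mem_of_strip t u hz; tauto
      · have := h.mem_of_strip w s hz; tauto
      · have := h.mem_of_strip v w hz; tauto
  have a1 := h.adj
  have a2 := h.adj_of_far_right s.right_fst
  have a3 := h.adj_of_far_right s.right_snd
  have a4 := h.adj_of_far_right u.right_fst
  have a5 := h.adj_of_far_right u.right_snd
  have a6 := h.adj_of_far_right w.right_fst
  have a7 := h.swap.adj_of_far_right s.left_fst
  have a8 := h.swap.adj_of_far_right s.left_snd
  have a9 := h.swap.adj_of_far_right u.left_fst
  have a10 := h.swap.adj_of_far_right u.left_snd
  have a11 := h.swap.adj_of_far_right w.left_fst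
  have b1 := h.adj_left s t
  have b2 := h.adj_left t u
  have b3 := h.adj_left u v
  have b4 := h.adj_left v w
  have b5 := h.adj_left w s
  have c1 := h.adj_right s t
  have c2 := h.adj_right t u
  have c3 := h.adj_right u v
  have c4 := h.adj_right v w
  have c5 := h.adj_right w s
  have d1 := h.adj_diag s t
  have d2 := h.adj_diag t u
  have d3 := h.adj_diag u v
  have d4 := h.adj_diag v w
  have d5 := h.adj_diag w s
  have e1 := h.adj_long s t u c4
  have e2 := h.adj_long t u v c5
  have e3 := h.adj_long u v w c1
  have e4 := h.adj_long v w s c2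
  have e5 := h.adj_long w s t c3
  obtain ⟨s1, s2, s3, s4, s5, s6, -, s7, s8, s9⟩ := s
  obtain ⟨t1, t2, t3, t4, t5, t6, -, t7, t8, t9⟩ := t
  obtain ⟨u1, u2, u3, u4, u5, u6, -, u7, u8, u9⟩ := u
  obtain ⟨v1, v2, v3, v4, v5, v6, -, v7, v8, v9⟩ := v
  obtain ⟨w1, w2, w3, w4, w5, w6, -, w7, w8, w9⟩ := w
  refine nonempty_iso (F := [(0, 6), (0, 7), (0, 9), (0, 10), (0, 11), (1, 4), (1, 5), (1, 8),
    (1, 10), (1, 11), (2, 3), (2, 5), (2, 7), (2, 8), (2, 9), (3, 4), (3, 6), (3, 8), (3, 9),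
    (4, 6), (4, 8), (4, 11), (5, 7), (5, 8), (5, 10), (6, 9), (6, 11), (7, 9), (7, 10), (10, 11)])
    _ hsurj ?_ ?_ (by decide)
  · simp only [edgesP12, List.forall_mem_cons]
    repeat' first | assumption | exact SimpleGraph.Adj.symm (by assumption) | constructor | simp
  · simp only [List.forall_mem_cons]
    repeat' first | assumption | exact Far.symm (by assumption) | constructor | simp

end IsDominating

/-- A locally triangle-free graph in `W₂` with independence number three that is not a join and has
two adjacent vertices without common non-neighbour is `P10` or `P12`. -/
theorem IsLTFW2.nonempty_iso_P10_or_P12 [Fintype V] {G : SimpleGraph V} (h : IsLTFW2 G 3)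
    (hjoin : ¬ IsJoin G) (hcf : ¬ CommonFar G) :
    Nonempty (G ≃g P10) ∨ Nonempty (G ≃g P12) := by
  simp only [CommonFar, not_forall, not_exists, not_and] at hcf
  obtain ⟨a, b', hab', hno'⟩ := hcf
  obtain ⟨b, x₀, y₀, hab, hno, hax, hby, hxy⟩ := exists_geodesic_of_not_isJoin hjoin hab' hno'
  replace h : IsDominating G a b := { h with adj := hab, not_far := hno }
  obtain ⟨y₁, hby₁, hxy₁, hyy⟩ := h.exists_far_right hax hby hxy
  obtain ⟨x₁, s⟩ := h.exists_strip hax hby hby₁ hxy hxy₁ hyy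
  obtain ⟨x₂, y₂, t⟩ := h.exists_next s
  obtain ⟨x₃, y₃, u⟩ := h.exists_next t
  obtain ⟨x₄, y₄, v⟩ := h.exists_next u
  obtain ⟨x₅, y₅, w⟩ := h.exists_next v
  by_cases h04 : x₄ = x₀
  · subst h04
    refine Or.inl (h.nonempty_iso_P10 hjoin s t u (y₀ := y₀) ?_)
    rcases h.eq_or_eq_of_strip s v.snd v.right_snd with rfl | rfl
    · exact v
    · rcases h.swap.eq_or_eq_of_strip s.swap v.cross.symm v.left_fst with h' | h'
      · exact absurd h'.symm (h.adj_left t u).ne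
      · exact absurd h' v.left.1
  · have hx : Far G x₄ x₀ := by
      refine ⟨h04, fun hadj => ?_⟩
      exact h.not_triangle a x₀ x₂ x₄ hax t.left_snd v.left_snd (h.adj_left s t) (h.adj_left u v)
        hadj.symm
    rcases h.eq_or_eq_of_far v.left_snd v.left_fst w.left_snd hax v.left.symm w.left hx
      (h.adj_left v w).ne with rfl | rfl
    · exact absurd (h.adj_left s t) u.left.symm.2
    refine Or.inr (h.nonempty_iso_P12 hjoin s t u v (y₀ := y₀) ?_)
    rcases h.eq_or_eq_of_strip s w.snd w.right_snd with rfl | rfl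
    · exact w
    · rcases h.swap.eq_or_eq_of_strip s.swap w.cross.symm w.left_fst with rfl | rfl
      · exact absurd (h.adj_left u v).symm t.left.2
      · exact absurd rfl h04

section Reverse

variable {G : SimpleGraph V} {n : ℕ}

/-- Decides whether all sequences of pairwise non-adjacent vertices of `C` extend to sequences of
length exactly `n`, and whether in each of the extension steps all the possible vertices have
a neighbour among the possible vertices. -/
def checkW2 (G : SimpleGraph V) [DecidableEq V] [DecidableRel G.Adj] : ℕ → List V → Bool
  | 0, C => C.isEmpty
  | n + 1, C => !C.isEmpty && C.all fun v => C.any (fun w => decide (G.Adj v w)) &&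
      checkW2 G n (C.filter fun w => decide (v ≠ w) && !decide (G.Adj v w))

theorem checkW2_sound [DecidableEq V] [DecidableRel G.Adj] {C : List V} (h : checkW2 G n C = true)
    {S : Finset V} (hS : Indep G S) (hSC : ∀ s ∈ S, s ∈ C) :
    S.card ≤ n ∧ (S.card < n → ∃ v ∈ C, Link G S v) ∧
      ∀ v ∈ C, Link G S v → ∃ w ∈ C, Link G S w ∧ G.Adj v w := by
  induction n generalizing C S with
  | zero =>
    obtain rfl : C = [] := by simpa [checkW2] using h
    obtain rfl : S = ∅ := Finset.eq_empty_of_forall_notMem fun s hs => by simpa using hSC s hs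
    simp
  | succ n ih =>
    simp only [checkW2, Bool.and_eq_true, List.all_eq_true, List.any_eq_true, decide_eq_true_eq,
      Bool.not_eq_true', List.isEmpty_eq_false_iff] at h
    obtain ⟨hne, h⟩ := h
    rcases S.eq_empty_or_nonempty with rfl | ⟨s, hs⟩
    · refine ⟨by simp, fun _ => ?_, fun v hv _ => ?_⟩
      · exact ⟨C.head hne, List.head_mem hne, by simp [Link]⟩
      · obtain ⟨w, hw, hvw⟩ := (h v hv).1
        exact ⟨w, hw, by simp [Link], hvw⟩
    · have hmem : ∀ w, w ∈ C.filter (fun w => decide (s ≠ w) && !decide (G.Adj s w)) ↔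
          w ∈ C ∧ Far G s w := fun w => by simp [Far]
      obtain ⟨h1, h2, h3⟩ := ih (h s (hSC s hs)).2 (S := S.erase s)
        (hS.mono (Finset.erase_subset s S)) fun t ht => (hmem t).2
          ⟨hSC t (Finset.mem_of_mem_erase ht), (Finset.ne_of_mem_erase ht).symm,
            hS s hs t (Finset.mem_of_mem_erase ht)⟩
      have hcard := Finset.card_erase_add_one hs
      have hlink : ∀ w, Link G S w ↔ Far G s w ∧ Link G (S.erase s) w := fun w => by
        rw [← link_insert, Finset.insert_erase hs]
      refine ⟨by omega, fun hlt => ?_, fun v hv hvS => ?_⟩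
      · obtain ⟨v, hv, hvS⟩ := h2 (by omega)
        exact ⟨v, ((hmem v).1 hv).1, (hlink v).2 ⟨((hmem v).1 hv).2, hvS⟩⟩
      · rw [hlink] at hvS
        obtain ⟨w, hw, hwS, hvw⟩ := h3 v ((hmem v).2 ⟨hv, hvS.1⟩) hvS.2
        exact ⟨w, ((hmem w).1 hw).1, (hlink w).2 ⟨((hmem w).1 hw).2, hwS⟩, hvw⟩

theorem isLTFW2_of_checkW2 {m : ℕ} {G : SimpleGraph (Fin m)} [DecidableRel G.Adj]
    (h : checkW2 G n (List.finRange m) = true)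
    (ht : ∀ v x, v ≠ x ∧ ¬ G.Adj v x → ∀ y, G.Adj x y → v ≠ y ∧ ¬ G.Adj v y →
      ∀ z, G.Adj x z → G.Adj y z → ¬ (v ≠ z ∧ ¬ G.Adj v z)) : IsLTFW2 G n where
  card_le S hS := (checkW2_sound h hS fun s _ => List.mem_finRange s).1
  exists_link S hS hlt := by
    obtain ⟨v, -, hv⟩ := (checkW2_sound h hS fun s _ => List.mem_finRange s).2.1 hlt
    exact ⟨v, hv⟩
  exists_adj S v hS hv := by
    obtain ⟨w, -, hw⟩ :=
      (checkW2_sound h hS fun s _ => List.mem_finRange s).2.2 v (List.mem_finRange v) hv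
    exact ⟨w, hw⟩
  not_triangle v x y z hx hy hz hxy hyz hxz := ht v x hx y hxy hy z hxz hyz hz

instance : DecidableRel Q9.Adj :=
  inferInstanceAs (DecidableRel (SimpleGraph.fromRel fun u v => (u, v) ∈ edgesQ9).Adj)

theorem isLTFW2_Q9 : IsLTFW2 Q9 3 :=
  isLTFW2_of_checkW2 (by decide +kernel) (by decide +kernel)

instance : DecidableRel Q12.Adj :=
  inferInstanceAs (DecidableRel (SimpleGraph.fromRel fun u v => (u, v) ∈ edgesQ12).Adj)

theorem isLTFW2_Q12 : IsLTFW2 Q12 4 :=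
  isLTFW2_of_checkW2 (by decide +kernel) (by decide +kernel)

instance : DecidableRel P10.Adj :=
  inferInstanceAs (DecidableRel (SimpleGraph.fromRel fun u v => (u, v) ∈ edgesP10).Adj)

theorem isLTFW2_P10 : IsLTFW2 P10 3 :=
  isLTFW2_of_checkW2 (by decide +kernel) (by decide +kernel)

instance : DecidableRel P12.Adj :=
  inferInstanceAs (DecidableRel (SimpleGraph.fromRel fun u v => (u, v) ∈ edgesP12).Adj)

theorem isLTFW2_P12 : IsLTFW2 P12 3 :=
  isLTFW2_of_checkW2 (by decide +kernel) (by decide +kernel)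

theorem IsLTFW2.of_iso {W : Type*} {H : SimpleGraph W} (h : IsLTFW2 H n) (e : G ≃g H) :
    IsLTFW2 G n := by
  have hfar : ∀ x y, Far H (e x) (e y) ↔ Far G x y := fun x y => by
    simp [Far, e.map_adj_iff]
  have hind : ∀ S, Indep G S → Indep H (S.map e.toEquiv.toEmbedding) := fun S hS => by
    intro u hu v hv
    obtain ⟨x, hx, rfl⟩ := Finset.mem_map.1 hu
    obtain ⟨y, hy, rfl⟩ := Finset.mem_map.1 hv
    exact fun hxy => hS x hx y hy (e.map_adj_iff.1 hxy)
  have hlink : ∀ S v, Link H (S.map e.toEquiv.toEmbedding) (e v) ↔ Link G S v := fun S v => by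
    simp only [Link, Finset.forall_mem_map]
    exact forall₂_congr fun s _ => hfar s v
  refine ⟨⟨fun S hS => ?_, fun S hS hlt => ?_, fun S v hS hv => ?_⟩, ?_⟩
  · simpa using h.card_le _ (hind S hS)
  · obtain ⟨w, hw⟩ := h.exists_link _ (hind S hS) (by simpa using hlt)
    obtain ⟨v, rfl⟩ := e.surjective w
    exact ⟨v, (hlink S v).1 hw⟩
  · obtain ⟨w, hw, hvw⟩ := h.exists_adj _ _ (hind S hS) ((hlink S v).2 hv)
    obtain ⟨w, rfl⟩ := e.surjective w
    exact ⟨w, (hlink S w).1 hw, e.map_adj_iff.1 hvw⟩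
  · intro v x y z hx hy hz hxy hyz hxz
    exact h.not_triangle (e v) (e x) (e y) (e z) ((hfar _ _).2 hx) ((hfar _ _).2 hy)
      ((hfar _ _).2 hz) (e.map_adj_iff.2 hxy) (e.map_adj_iff.2 hyz) (e.map_adj_iff.2 hxz)

theorem IsLTFW2.locallyTriangleFree (h : IsLTFW2 G n) : LocallyTriangleFree G := by
  intro v
  have key : ∀ u ∈ GDel G {v}, Far G v u := fun u hu =>
    ⟨fun h' => hu.2 (Or.inl h'.symm), fun h' => hu.2 (Or.inr ⟨v, rfl, h'⟩)⟩
  exact fun x hx y hy z hz ⟨h1, h2, h3⟩ =>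
    h.not_triangle v x y z (key x hx) (key y hy) (key z hz) h1 h2 h3

theorem LocallyTriangleFree.of_triangleFreeOn (h : TriangleFreeOn G Set.univ) :
    LocallyTriangleFree G :=
  fun _ x _ y _ z _ => h x (mem_univ x) y (mem_univ y) z (mem_univ z)

end Reverse

/-- Classification: a graph with `α(G) ≥ 3` that is not a join of two proper
subgraphs is a locally triangle-free graph in `W₂` iff it is triangle-free and
in `W₂`, or isomorphic to one of `Q₉`, `Q₁₂`, `P₁₀`, `P₁₂`. -/
theorem stmt_17 [Fintype V] (G : SimpleGraph V)
    (hα : 3 ≤ indepNum G) (hjoin : ¬ IsJoin G) :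
    (LocallyTriangleFree G ∧ W2 G) ↔
      ((TriangleFreeOn G Set.univ ∧ W2 G) ∨
        Nonempty (G ≃g Q9) ∨ Nonempty (G ≃g Q12) ∨
        Nonempty (G ≃g P10) ∨ Nonempty (G ≃g P12)) := by
  constructor
  · rintro ⟨hltf, hw2⟩
    have h : IsLTFW2 G (indepNum G) :=
      { hw2.isW2 with not_triangle := not_triangle_of_locallyTriangleFree hltf }
    by_cases htf : TriangleFreeOn G Set.univ
    · exact Or.inl ⟨htf, hw2⟩
    refine Or.inr ?_
    by_cases hcf : CommonFar G
    · simp only [TriangleFreeOn, not_forall, not_not] at htf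
      obtain ⟨a, -, b, -, c, -, hab, hbc, hac⟩ := htf
      have hT : HasTriangle G (indepNum G) a b c :=
        { h with
          three_le := hα
          commonFar := hcf
          adj_ab := hab
          adj_bc := hbc
          adj_ac := hac }
      exact hT.nonempty_iso_Q9_or_Q12.imp_right Or.inl
    · have hn : indepNum G = 3 := by
        by_contra hne
        exact hcf fun a b hab => h.exists_far_far (by omega) hjoin hab
      rw [hn] at h
      exact Or.inr (Or.inr (h.nonempty_iso_P10_or_P12 hjoin hcf))
  · rintro (⟨htf, hw2⟩ | ⟨⟨e⟩⟩ | ⟨⟨e⟩⟩ | ⟨⟨e⟩⟩ | ⟨⟨e⟩⟩)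
    · exact ⟨LocallyTriangleFree.of_triangleFreeOn htf, hw2⟩
    · have h := isLTFW2_Q9.of_iso e
      exact ⟨h.locallyTriangleFree, h.w2⟩
    · have h := isLTFW2_Q12.of_iso e
      exact ⟨h.locallyTriangleFree, h.w2⟩
    · have h := isLTFW2_P10.of_iso e
      exact ⟨h.locallyTriangleFree, h.w2⟩
    · have h := isLTFW2_P12.of_iso e
      exact ⟨h.locallyTriangleFree, h.w2⟩
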